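/- arXiv:2511.12283 — 5 statements merged into one kernel-verified Lean document; each statement's English description precedes it below -/
import Mathlib

section
/- Let B be a bidirected graph and let X and Y be sets of vertices of B such that there is either no nontrivial X–X path in B or no nontrivial Y–Y path in B. Then the maximum number of pairwise vertex-disjoint X–Y paths in B is equal to the minimum size of a set S of vertices of B such that B − S contains no X–Y path. -/
/-- A bidirected graph: each edge `e` has two endpoints `fst e` and `snd e`
(possibly equal), and each of its two edge–endpoint incidences carries a sign
(`true` = `+`, `false` = `-`). -/
structure BidirGraph (V E : Type) where
  fst : E → V
  snd : E → V
  sgnFst : E → Bool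
  sgnSnd : E → Bool

namespace BidirGraph

variable {V E : Type}

/-- Tail of edge `e` traversed in direction `d` (`true` = from `fst` to `snd`). -/
def tl (B : BidirGraph V E) (e : E) (d : Bool) : V := if d then B.fst e else B.snd e

/-- Head of edge `e` traversed in direction `d`. -/
def hd (B : BidirGraph V E) (e : E) (d : Bool) : V := if d then B.snd e else B.fst e

/-- Sign of edge `e` at its tail when traversed in direction `d`. -/
def tlSgn (B : BidirGraph V E) (e : E) (d : Bool) : Bool :=
  if d then B.sgnFst e else B.sgnSnd e

/-- Sign of edge `e` at its head when traversed in direction `d`. -/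
def hdSgn (B : BidirGraph V E) (e : E) (d : Bool) : Bool :=
  if d then B.sgnSnd e else B.sgnFst e

/-- A walk of length `n` in a bidirected graph: an alternating sequence
`v₀, e₁, v₁, …, eₙ, vₙ` where each edge `eᵢ` joins `vᵢ₋₁` and `vᵢ` (in the
traversal direction `dir i`), and consecutive edges have opposite signs at
their common vertex. -/
structure Walk (B : BidirGraph V E) (n : ℕ) where
  vert : Fin (n + 1) → V
  edge : Fin n → E
  dir : Fin n → Bool
  tail_eq : ∀ i : Fin n, B.tl (edge i) (dir i) = vert i.castSucc
  head_eq : ∀ i : Fin n, B.hd (edge i) (dir i) = vert i.succ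
  sign_alt : ∀ i j : Fin n, (i : ℕ) + 1 = (j : ℕ) →
    B.hdSgn (edge i) (dir i) ≠ B.tlSgn (edge j) (dir j)

variable {B : BidirGraph V E}

/-- A walk is a path if its vertices are pairwise distinct. -/
def Walk.IsPath {n : ℕ} (W : B.Walk n) : Prop := Function.Injective W.vert

/-- The set of vertices of a walk. -/
def Walk.verts {n : ℕ} (W : B.Walk n) : Set V := Set.range W.vert

/-- A walk avoids a vertex set `S` if none of its vertices lies in `S`. -/
def Walk.Avoids {n : ℕ} (W : B.Walk n) (S : Set V) : Prop := ∀ i, W.vert i ∉ S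

/-- There is an `X`–`Y` path in `B - S`. -/
def ExistsPathAvoiding (B : BidirGraph V E) (X Y S : Set V) : Prop :=
  ∃ (n : ℕ) (W : B.Walk n), W.IsPath ∧ W.vert 0 ∈ X ∧ W.vert (Fin.last n) ∈ Y ∧ W.Avoids S

/-- There is a nontrivial `X`–`Y` path in `B`. -/
def ExistsNontrivialPath (B : BidirGraph V E) (X Y : Set V) : Prop :=
  ∃ n : ℕ, 0 < n ∧ ∃ W : B.Walk n, W.IsPath ∧ W.vert 0 ∈ X ∧ W.vert (Fin.last n) ∈ Y

end BidirGraph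

open BidirGraph
namespace BidirProof

theorem split_first {α : Type} (p : α → Prop) (l : List α) (h : ∃ v ∈ l, p v) :
    ∃ l1 v l2, l = l1 ++ v :: l2 ∧ p v ∧ ∀ w ∈ l1, ¬ p w := by
  induction l with
  | nil => simp at h
  | cons a l ih =>
    by_cases ha : p a
    · exact ⟨[], a, l, by simp, ha, by simp⟩
    · have : ∃ v ∈ l, p v := by
        obtain ⟨v, hv, hp⟩ := h
        rcases List.mem_cons.1 hv with rfl | hv
        · exact absurd hp ha
        · exact ⟨v, hv, hp⟩
      obtain ⟨l1, v, l2, rfl, hv, hw⟩ := ih this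
      refine ⟨a :: l1, v, l2, by simp, hv, ?_⟩
      intro w hw'
      rcases List.mem_cons.1 hw' with rfl | h'
      · exact ha
      · exact hw w h'

theorem split_last {α : Type} (p : α → Prop) (l : List α) (h : ∃ v ∈ l, p v) :
    ∃ l1 v l2, l = l1 ++ v :: l2 ∧ p v ∧ ∀ w ∈ l2, ¬ p w := by
  obtain ⟨l1, v, l2, h1, h2, h3⟩ := split_first p l.reverse (by simpa using h)
  refine ⟨l2.reverse, v, l1.reverse, ?_, h2, by simpa using h3⟩
  rw [← List.reverse_inj, h1]; simp

/-- relation from a finset of arcs -/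
def rel {V : Type} (F : Finset (V × V)) (u v : V) : Prop := (u, v) ∈ F

theorem chain_avoid_tail {V : Type} [DecidableEq V] (F : Finset (V × V)) (x y : V) (l : List V) :
    ∀ v, List.IsChain (rel (insert (x, y) F)) (l ++ [v]) → (∀ w ∈ l, w ≠ x) →
      List.IsChain (rel F) (l ++ [v]) := by
  induction l with
  | nil => intro v _ _; simp
  | cons a l ih =>
    intro v hc hx
    simp only [List.cons_append, List.isChain_cons] at hc ⊢
    refine ⟨?_, ih v hc.2 (fun w hw => hx w (by simp [hw]))⟩
    intro b hb
    have := hc.1 b hb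
    have ha := hx a (by simp)
    simp only [rel, Finset.mem_insert, Prod.mk.injEq] at this ⊢
    tauto

theorem chain_avoid_head {V : Type} [DecidableEq V] (F : Finset (V × V)) (x y : V) (l : List V) :
    ∀ v, List.IsChain (rel (insert (x, y) F)) (v :: l) → (∀ w ∈ l, w ≠ y) →
      List.IsChain (rel F) (v :: l) := by
  induction l with
  | nil => intro v _ _; simp
  | cons a l ih =>
    intro v hc hx
    rw [List.isChain_cons_cons] at hc ⊢
    refine ⟨?_, ih a hc.2 (fun w hw => hx w (by simp [hw]))⟩
    have := hc.1
    have ha := hx a (by simp)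
    simp only [rel, Finset.mem_insert, Prod.mk.injEq] at this ⊢
    tauto

def Sep {V : Type} (F : Finset (V × V)) (A B : Set V) (S : Finset V) : Prop :=
  ∀ l : List V, l.IsChain (rel F) → (∃ a ∈ A, l.head? = some a) →
    (∃ b ∈ B, l.getLast? = some b) → ∃ v ∈ l, v ∈ S

def Linked {V : Type} (F : Finset (V × V)) (A B : Set V) (k : ℕ) : Prop :=
  ∃ P : Fin k → List V, (∀ i, (P i).IsChain (rel F)) ∧ (∀ i, (P i).Nodup) ∧
    (∀ i, ∃ a ∈ A, (P i).head? = some a) ∧ (∀ i, ∃ b ∈ B, (P i).getLast? = some b) ∧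
    ∀ i j, i ≠ j → List.Disjoint (P i) (P j)

theorem surj_of {V : Type} [DecidableEq V] {k : ℕ} (T : Finset V) (hT : T.card = k)
    (P : Fin k → List V) (hd : ∀ i j, i ≠ j → List.Disjoint (P i) (P j))
    (e : Fin k → V) (he : ∀ i, e i ∈ T) (heP : ∀ i, e i ∈ P i) :
    (∀ t ∈ T, ∃ i, e i = t) ∧ (∀ i, ∀ w ∈ P i, w ∈ T → w = e i) := by
  have inj : Function.Injective e := by
    intro i j hij
    by_contra hne
    exact hd i j hne (heP i) (hij ▸ heP j)
  have him : Finset.univ.image e = T := by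
    apply Finset.eq_of_subset_of_card_le
    · intro w hw
      obtain ⟨i, _, rfl⟩ := Finset.mem_image.1 hw
      exact he i
    · rw [Finset.card_image_of_injective _ inj]; simp [hT]
  have hs : ∀ t ∈ T, ∃ i, e i = t := by
    intro t ht
    rw [← him] at ht
    simpa using ht
  refine ⟨hs, fun i w hw hwT => ?_⟩
  obtain ⟨j, rfl⟩ := hs w hwT
  by_contra hne
  have : i ≠ j := by rintro rfl; exact hne rfl
  exact hd i j this hw (heP j)

theorem menger_dir {V : Type} [Fintype V] [DecidableEq V] (F : Finset (V × V)) :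
    ∀ (A B : Set V) (k : ℕ), (∀ S, Sep F A B S → k ≤ S.card) → Linked F A B k := by
  classical
  induction F using Finset.induction_on with
  | empty =>
    intro A B k h
    have h1 := h (Finset.univ.filter (fun v => v ∈ A ∧ v ∈ B)) (by
      rintro l hl ⟨a, ha, hla⟩ ⟨b, hb, hlb⟩
      match l, hl with
      | [], _ => simp at hla
      | [c], _ =>
        simp at hla hlb
        subst hla; subst hlb
        exact ⟨c, by simp, by simp [ha, hb]⟩
      | c :: d :: l, hl =>
        rw [List.isChain_cons_cons] at hl
        simp [rel] at hl)
    obtain ⟨T, hT, hTc⟩ := Finset.exists_subset_card_eq h1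
    let f := T.equivFinOfCardEq hTc
    have hf : ∀ i, ((f.symm i : V) ∈ A ∧ (f.symm i : V) ∈ B) := by
      intro i
      have := hT (f.symm i).2
      simpa using this
    refine ⟨fun i => [(f.symm i : V)], by simp, by simp, fun i => ⟨_, (hf i).1, by simp⟩,
      fun i => ⟨_, (hf i).2, by simp⟩, ?_⟩
    intro i j hij
    simp only [List.disjoint_singleton, List.mem_singleton]
    intro h'
    apply hij
    exact f.symm.injective (Subtype.ext (by first | exact h' | exact h'.symm))
  | insert e F heF ih =>
    obtain ⟨x, y⟩ := e
    intro A B k h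
    have mono : ∀ u v, rel F u v → rel (insert (x, y) F) u v := fun u v huv =>
      Finset.mem_insert_of_mem huv
    by_cases hall : ∀ S, Sep F A B S → k ≤ S.card
    · obtain ⟨P, h1, h2⟩ := ih A B k hall
      exact ⟨P, fun i => (h1 i).imp mono, h2⟩
    push Not at hall
    obtain ⟨S, hS, hSk⟩ := hall
    -- all F+e walks hit S+x and S+y
    have sepx : Sep (insert (x, y) F) A B (insert x S) := by
      intro l hl ha hb
      by_cases hx : x ∈ l
      · exact ⟨x, hx, by simp⟩
      · obtain ⟨b, hbB, hlb⟩ := hb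
        obtain ⟨l', rfl⟩ : ∃ l', l = l' ++ [b] := by
          rw [List.getLast?_eq_some_iff] at hlb; exact hlb
        obtain ⟨v, hv, hvS⟩ := hS _ (chain_avoid_tail F x y l' b hl
          (fun w hw hwx => hx (by simp [← hwx, hw]))) ha ⟨b, hbB, hlb⟩
        exact ⟨v, hv, by simp [hvS]⟩
    have sepy : Sep (insert (x, y) F) A B (insert y S) := by
      intro l hl ha hb
      by_cases hy : y ∈ l
      · exact ⟨y, hy, by simp⟩
      · obtain ⟨a, haA, hla⟩ := ha
        obtain ⟨l', rfl⟩ : ∃ l', l = a :: l' := by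
          rw [List.head?_eq_some_iff] at hla; exact hla
        obtain ⟨v, hv, hvS⟩ := hS _ (chain_avoid_head F x y l' a hl
          (fun w hw hwx => hy (by simp [← hwx, hw]))) ⟨a, haA, hla⟩ hb
        exact ⟨v, hv, by simp [hvS]⟩
    have kx := h _ sepx
    have ky := h _ sepy
    have hxS : x ∉ S := by
      intro hx; rw [Finset.insert_eq_of_mem hx] at kx; omega
    have hyS : y ∉ S := by
      intro hx; rw [Finset.insert_eq_of_mem hx] at ky; omega
    have cx : (insert x S).card = k := by
      rw [Finset.card_insert_of_notMem hxS] at kx ⊢; omega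
    have cy : (insert y S).card = k := by
      rw [Finset.card_insert_of_notMem hyS] at ky ⊢; omega
    obtain ⟨P, Pc, Pn, Ph, Pl, Pd⟩ := ih A (↑(insert x S)) k (by
      intro T hT
      apply h
      intro l hl ha hb
      obtain ⟨l1, v, l2, rfl, hv, hw⟩ := split_first _ l (sepx l hl ha hb)
      obtain ⟨t, ht, htT⟩ := hT (l1 ++ [v])
        (by
          apply chain_avoid_tail F x y
          · have : l1 ++ v :: l2 = (l1 ++ [v]) ++ l2 := by simp
            rw [this] at hl
            exact (List.isChain_append.1 hl).1
          · rintro w hw' rfl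
            exact hw w hw' (by simp))
        (by
          obtain ⟨a, haA, hla⟩ := ha
          refine ⟨a, haA, ?_⟩
          cases l1 <;> simpa using hla)
        ⟨v, by exact_mod_cast hv, by simp⟩
      refine ⟨t, ?_, htT⟩
      simp at ht ⊢; tauto)
    obtain ⟨Q, Qc, Qn, Qh, Ql, Qd⟩ := ih (↑(insert y S)) B k (by
      intro T hT
      apply h
      intro l hl ha hb
      obtain ⟨l1, v, l2, rfl, hv, hw⟩ := split_last _ l (sepy l hl ha hb)
      obtain ⟨t, ht, htT⟩ := hT (v :: l2)
        (by
          apply chain_avoid_head F x y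
          · exact (List.isChain_append.1 hl).2.1
          · rintro w hw' rfl
            exact hw w hw' (by simp))
        ⟨v, by exact_mod_cast hv, by simp⟩
        (by
          obtain ⟨a, haA, hla⟩ := hb
          refine ⟨a, haA, ?_⟩
          simpa using hla)
      refine ⟨t, ?_, htT⟩
      simp at ht ⊢; tauto)
    choose e he heP using Pl
    choose b hb hbQ using Qh
    have memP : ∀ i, e i ∈ P i := fun i => List.mem_of_getLast? (heP i)
    have memQ : ∀ i, b i ∈ Q i := fun i => List.mem_of_head? (hbQ i)
    obtain ⟨sP, uP⟩ := surj_of _ cx P Pd e (fun i => by exact_mod_cast he i) memP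
    obtain ⟨sQ, uQ⟩ := surj_of _ cy Q Qd b (fun i => by exact_mod_cast hb i) memQ
    have key : ∀ i j z, z ∈ P i → z ∈ Q j → z ∈ S := by
      intro i j z hzP hzQ
      by_contra hzS
      obtain ⟨p1, p2, hp⟩ := List.append_of_mem hzP
      obtain ⟨q1, q2, hq⟩ := List.append_of_mem hzQ
      have c1 := Pc i
      have c2 := Qc j
      have n1 := Pn i
      have n2 := Qn j
      obtain ⟨a, ha, hPa⟩ := Ph i
      obtain ⟨d, hd, hQd⟩ := Ql j
      have l1 := heP i
      have l2 := hbQ j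
      have u1 := uP i
      have u2 := uQ j
      rw [hp] at c1 n1 hPa l1 u1
      rw [hq] at c2 n2 hQd l2 u2
      obtain ⟨w, hw, hwS⟩ := hS (p1 ++ z :: q2)
        (by
          rw [List.isChain_append] at c1 c2 ⊢
          refine ⟨c1.1, c2.2.1, ?_⟩
          simpa using c1.2.2)
        ⟨a, ha, by cases p1 <;> simpa using hPa⟩ ⟨d, hd, by simpa using hQd⟩
      rw [List.mem_append, List.mem_cons] at hw
      rcases hw with hw | rfl | hw
      · have hwe := u1 w (by simp [hw]) (by simp [hwS])
        have : e i ∈ z :: p2 := List.mem_of_getLast? (by simpa using l1)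
        rw [List.nodup_append] at n1
        exact n1.2.2 w hw w (hwe ▸ this) rfl
      · exact hzS hwS
      · have hwe := u2 w (by simp [hw]) (by simp [hwS])
        have : b j ∈ q1 ++ [z] := List.mem_of_head? (by cases q1 <;> simpa using l2)
        rw [← hwe] at this
        rw [List.nodup_append, List.nodup_cons] at n2
        rw [List.mem_append, List.mem_singleton] at this
        rcases this with h' | h'
        · exact n2.2.2 w h' w (by simp [hw]) rfl
        · exact n2.2.1.1 (h' ▸ hw)
    have ht : ∀ j, ∃ i, e i = if b j = y then x else b j := by
      intro j
      apply sP
      have := hb j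
      split_ifs with hby
      · simp
      · simp [hby] at this ⊢; tauto
    choose i hi using ht
    have binj : ∀ j j', b j = b j' → j = j' := by
      intro j j' hjj
      by_contra hne
      exact Qd j j' hne (memQ j) (hjj ▸ memQ j')
    have hbS : ∀ j, b j ≠ y → b j ∈ S := by
      intro j hj
      have := hb j
      simp [hj] at this; exact this
    have iinj : ∀ j j', i j = i j' → j = j' := by
      intro j j' hjj
      have h1 := hi j
      have h2 := hi j'
      rw [hjj, h2] at h1
      apply binj
      split_ifs at h1 with c1 c2 c2
      · rw [c1, c2]
      · exact absurd (h1 ▸ hbS _ c2) hxS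
      · exact absurd (h1.symm ▸ hbS _ c1) hxS
      · exact h1.symm
    let Q' : Fin k → List V := fun j => if b j = y then Q j else (Q j).tail
    have subQ : ∀ j, ∀ w ∈ Q' j, w ∈ Q j := by
      intro j w hw
      simp only [Q'] at hw
      split_ifs at hw
      · exact hw
      · exact List.mem_of_mem_tail hw
    have disj : ∀ i j, List.Disjoint (P i) (Q' j) := by
      intro i j z hz1 hz2
      have hzS := key i j z hz1 (subQ j z hz2)
      have hzb := uQ j z (subQ j z hz2) (by simp [hzS])
      have hby : b j ≠ y := by rintro hby; exact hyS (hby ▸ hzb ▸ hzS)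
      simp only [Q', if_neg hby] at hz2
      obtain ⟨q, hq⟩ := List.head?_eq_some_iff.1 (hbQ j)
      have := Qn j
      rw [hq] at this hz2
      simp at hz2
      rw [List.nodup_cons] at this
      exact this.1 (hzb ▸ hz2)
    refine ⟨fun j => P (i j) ++ Q' j, ?_, ?_, ?_, ?_, ?_⟩
    · intro j
      have cQ := (Qc j).imp mono
      obtain ⟨q, hq⟩ := List.head?_eq_some_iff.1 (hbQ j)
      rw [hq] at cQ
      rw [List.isChain_append]
      refine ⟨(Pc (i j)).imp mono, ?_, ?_⟩
      · simp only [Q']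
        split_ifs
        · rw [hq]; exact cQ
        · rw [hq]; exact (List.isChain_cons.1 cQ).2
      · intro u hu v hv
        rw [heP, Option.mem_some_iff] at hu
        subst hu
        rw [hi]
        simp only [Q'] at hv
        split_ifs at hv ⊢ with hby
        · rw [hbQ, hby, Option.mem_some_iff] at hv
          subst hv
          simp [rel]
        · rw [hq] at hv
          exact (List.isChain_cons.1 cQ).1 v hv
    · intro j
      rw [List.nodup_append']
      refine ⟨Pn _, ?_, disj _ _⟩
      simp only [Q']
      split_ifs
      · exact Qn j
      · exact (Qn j).tail
    · intro j
      obtain ⟨a, ha, hPa⟩ := Ph (i j)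
      exact ⟨a, ha, by simp [hPa]⟩
    · intro j
      obtain ⟨d, hd, hQd⟩ := Ql j
      refine ⟨d, hd, ?_⟩
      simp only [Q']
      split_ifs with hby
      · simp [hQd]
      · obtain ⟨q, hq⟩ := List.head?_eq_some_iff.1 (hbQ j)
        have h1 := heP (i j)
        rw [hi, if_neg hby] at h1
        rw [hq] at hQd ⊢
        rcases List.eq_nil_or_concat q with rfl | ⟨q', w, rfl⟩
        · simp at hQd ⊢
          rw [h1, hQd]
        · simp [List.getLast?_cons] at hQd ⊢
          exact hQd
    · intro j j' hjj
      have hii : i j ≠ i j' := fun h' => hjj (iinj _ _ h')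
      intro z hz1 hz2
      rcases List.mem_append.1 hz1 with h1 | h1 <;> rcases List.mem_append.1 hz2 with h2 | h2
      · exact Pd _ _ hii h1 h2
      · exact disj _ _ h1 h2
      · exact disj _ _ h2 h1
      · exact Qd _ _ hjj (subQ _ _ h1) (subQ _ _ h2)

/-! ### Skew-symmetric state graphs -/

def bar {V : Type} (p : V × Bool) : V × Bool := (p.1, !p.2)

@[simp] theorem bar_bar {V : Type} (p : V × Bool) : bar (bar p) = p := by simp [bar]
@[simp] theorem bar_fst {V : Type} (p : V × Bool) : (bar p).1 = p.1 := rfl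

def rv {V : Type} (l : List (V × Bool)) : List (V × Bool) := (l.map bar).reverse

def VN {V : Type} (l : List (V × Bool)) : Prop := (l.map Prod.fst).Nodup

theorem VN.app {V : Type} {l1 l2 : List (V × Bool)} (h1 : VN l1) (h2 : VN l2)
    (h : ∀ p ∈ l1, ∀ q ∈ l2, p.1 ≠ q.1) : VN (l1 ++ l2) := by
  unfold VN at *
  rw [List.map_append, List.nodup_append]
  refine ⟨h1, h2, ?_⟩
  intro a ha b hb
  obtain ⟨p, hp, rfl⟩ := List.mem_map.1 ha
  obtain ⟨q, hq, rfl⟩ := List.mem_map.1 hb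
  exact h p hp q hq

theorem VN.rv {V : Type} {l : List (V × Bool)} (h : VN l) : VN (rv l) := by
  unfold VN BidirProof.rv at *
  rw [List.map_reverse, List.nodup_reverse, List.map_map]
  exact h

theorem mem_rv {V : Type} {l : List (V × Bool)} {p : V × Bool} : p ∈ rv l ↔ bar p ∈ l := by
  unfold rv
  rw [List.mem_reverse, List.mem_map]
  constructor
  · rintro ⟨q, hq, rfl⟩; simpa using hq
  · intro h; exact ⟨_, h, by simp⟩

theorem rv_head {V : Type} (l : List (V × Bool)) : (rv l).head? = l.getLast?.map bar := by
  simp [rv]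

theorem rv_last {V : Type} (l : List (V × Bool)) : (rv l).getLast? = l.head?.map bar := by
  simp [rv]

theorem chain_rv {V : Type} {st : V × Bool → V × Bool → Prop}
    (sk : ∀ p q, st p q → st (bar q) (bar p)) {l : List (V × Bool)} (h : l.IsChain st) :
    (rv l).IsChain st := by
  unfold rv
  rw [List.isChain_reverse, List.isChain_map]
  exact h.imp (fun a b hab => sk a b hab)

structure Str {V : Type} (st : V × Bool → V × Bool → Prop) (X : Set V)
    (O : Set (V × Bool)) (ρ : V → V) (d : V → ℕ) : Prop where
  hX : ∀ x ∈ X, ∀ s, (x, s) ∈ O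
  hXr : ∀ x ∈ X, ρ x = x
  hXd : ∀ x ∈ X, d x = 0
  hρ : ∀ v, ρ (ρ v) = ρ v
  hout : ∀ v, ρ v ≠ v → ∀ s, (v, s) ∈ O
  huniq : ∀ v s, ρ v = v → v ∉ X → (v, s) ∈ O → (v, !s) ∉ O
  hin : ∀ p ∈ O, ∃ l t, l.IsChain st ∧ VN l ∧ l.head? = some (ρ p.1, t) ∧ (ρ p.1, t) ∈ O ∧
    l.getLast? = some p ∧ ∀ w ∈ l, ρ w.1 = ρ p.1
  hpar : ∀ r s, ρ r = r → r ∉ X → (r, s) ∈ O → ∃ q ∈ O, st q (r, s) ∧ d (ρ q.1) < d r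

structure Bad {V : Type} (st : V × Bool → V × Bool → Prop) (X : Set V)
    (O : Set (V × Bool)) (ρ : V → V) (d : V → ℕ) (I : Set V) (p q : V × Bool) : Prop where
  hp : p ∈ O
  hq : q ∈ O
  cl : ∀ w w', w ∈ I → ρ w' = ρ w → w' ∈ I
  nX : ∀ w ∈ I, w ∉ X
  pI : p.1 ∉ I
  qI : q.1 ∉ I
  dp : ∀ w ∈ I, d (ρ p.1) ≤ d (ρ w)
  dq : ∀ w ∈ I, d (ρ q.1) ≤ d (ρ w)
  z : ∃ z, List.IsChain st (p :: (z ++ [bar q])) ∧ VN z ∧ ∀ w ∈ z, w.1 ∈ I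
  rch : ∀ w ∈ I, ∀ s, ∃ l, List.IsChain st l ∧ VN l ∧ (∀ u ∈ l, u.1 ∈ I) ∧
    l.getLast? = some (w, s) ∧ ((∀ y ∈ l.head?, st p y) ∨ (∀ y ∈ l.head?, st q y))
  ne : ρ p.1 ≠ ρ q.1 ∨ I.Nonempty

section
variable {V : Type} {st : V × Bool → V × Bool → Prop} {X : Set V}
  {O : Set (V × Bool)} {ρ : V → V} {d : V → ℕ}

theorem Bad.symm (sk : ∀ p q, st p q → st (bar q) (bar p)) {I : Set V} {p q : V × Bool}
    (h : Bad st X O ρ d I p q) : Bad st X O ρ d I q p := by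
  refine ⟨h.hq, h.hp, h.cl, h.nX, h.qI, h.pI, h.dq, h.dp, ?_, ?_, h.ne.imp Ne.symm id⟩
  · obtain ⟨z, hz, hn, hI⟩ := h.z
    refine ⟨rv z, ?_, hn.rv, fun w hw => hI (bar w) (mem_rv.1 hw)⟩
    have := chain_rv sk hz
    simpa [rv] using this
  · intro w hw s
    obtain ⟨l, h1, h2, h3, h4, h5⟩ := h.rch w hw s
    exact ⟨l, h1, h2, h3, h4, h5.symm⟩

theorem Str.rootO (h : Str st X O ρ d) {p : V × Bool} (hp : p ∈ O) : ∃ t, (ρ p.1, t) ∈ O := by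
  obtain ⟨l, t, _, _, _, h4, _⟩ := h.hin p hp
  exact ⟨t, h4⟩

/-- uniqueness of the outgoing sign at a root -/
theorem Str.uniq (h : Str st X O ρ d) {r : V} {s t : Bool} (hr : ρ r = r) (hX : r ∉ X)
    (h1 : (r, s) ∈ O) (h2 : (r, t) ∈ O) : s = t := by
  by_contra hne
  have : t = !s := by cases s <;> cases t <;> simp_all
  subst this
  exact h.huniq r s hr hX h1 h2

/-- the merge step -/
theorem merge (h : Str st X O ρ d) {I : Set V} {p q : V × Bool}
    (hb : Bad st X O ρ d I p q) (heq : ρ p.1 = ρ q.1) :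
    ∃ O' ρ', Str st X O' ρ' d ∧ O ⊂ O' := by
  classical
  have hIne : I.Nonempty := hb.ne.resolve_left (fun h' => h' heq)
  set r := ρ p.1 with hr
  have hrr : ρ r = r := h.hρ _
  have hrI : r ∉ I := fun hrI => hb.pI (hb.cl r p.1 hrI (by rw [hrr]))
  have hcl : ∀ w, w ∉ I → ρ w ∉ I := fun w hw hw' => hw (hb.cl _ w hw' (h.hρ w).symm)
  let ρ' : V → V := fun w => if w ∈ I then r else ρ w
  have ρI : ∀ w, w ∈ I → ρ' w = r := fun w hw => if_pos hw
  have ρn : ∀ w, w ∉ I → ρ' w = ρ w := fun w hw => if_neg hw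
  have ρroot : ∀ v, ρ' v = v → v ∉ I ∧ ρ v = v := by
    intro v hv
    have hvI : v ∉ I := by
      intro hvI
      rw [ρI v hvI] at hv
      exact hrI (hv ▸ hvI)
    exact ⟨hvI, by rw [← ρn v hvI]; exact hv⟩
  have Oout : ∀ v s, v ∉ I → (v, s) ∈ O ∪ {p | p.1 ∈ I} → (v, s) ∈ O := by
    intro v s hv hO
    rcases hO with hO | hO
    · exact hO
    · exact absurd hO hv
  refine ⟨O ∪ {p | p.1 ∈ I}, ρ', ?_, ?_⟩
  · constructor
    · intro x hx s; exact Or.inl (h.hX x hx s)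
    · intro x hx
      rw [ρn x (fun hI => hb.nX x hI hx)]; exact h.hXr x hx
    · exact h.hXd
    · intro v
      by_cases hv : v ∈ I
      · rw [ρI v hv, ρn r hrI, hrr]
      · rw [ρn v hv, ρn _ (hcl v hv), h.hρ]
    · intro v hv s
      by_cases hvI : v ∈ I
      · exact Or.inr hvI
      · rw [ρn v hvI] at hv
        exact Or.inl (h.hout v hv s)
    · intro v s hv hvX hO hO'
      obtain ⟨hvI, hv'⟩ := ρroot v hv
      exact h.huniq v s hv' hvX (Oout _ _ hvI hO) (Oout _ _ hvI hO')
    · intro w hw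
      by_cases hwI : w.1 ∈ I
      · rw [ρI _ hwI]
        obtain ⟨l, l1, l2, l3, l4, l5⟩ := hb.rch w.1 hwI w.2
        have : ∃ p' ∈ O, ρ p'.1 = r ∧ p'.1 ∉ I ∧ ∀ y ∈ l.head?, st p' y := by
          rcases l5 with l5 | l5
          · exact ⟨p, hb.hp, rfl, hb.pI, l5⟩
          · exact ⟨q, hb.hq, heq.symm, hb.qI, l5⟩
        obtain ⟨p', hp'O, hp'r, hp'I, hlink⟩ := this
        obtain ⟨c, t, c1, c2, c3, c4, c5, c6⟩ := h.hin p' hp'O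
        rw [hp'r] at c3 c4 c6
        have cI : ∀ u ∈ c, u.1 ∉ I := fun u hu huI =>
          hp'I (hb.cl u.1 p'.1 huI (by rw [c6 u hu, hp'r]))
        refine ⟨c ++ l, t, ?_, ?_, ?_, Or.inl c4, ?_, ?_⟩
        · rw [List.isChain_append]
          refine ⟨c1, l1, ?_⟩
          intro u hu y hy
          rw [c5, Option.mem_some_iff] at hu
          subst hu
          exact hlink y hy
        · exact c2.app l2 (fun u hu v hv huv => cI u hu (huv ▸ l3 v hv))
        · simp [c3]
        · simp [l4]
        · intro u hu
          rcases List.mem_append.1 hu with hu | hu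
          · rw [ρn _ (cI u hu), c6 u hu]
          · exact ρI _ (l3 u hu)
      · have hwO : w ∈ O := Oout w.1 w.2 hwI hw
        obtain ⟨c, t, c1, c2, c3, c4, c5, c6⟩ := h.hin w hwO
        rw [ρn _ hwI]
        refine ⟨c, t, c1, c2, c3, Or.inl c4, c5, ?_⟩
        intro u hu
        rw [ρn _ (fun huI => hwI (hb.cl u.1 w.1 huI (c6 u hu).symm)), c6 u hu]
    · intro v s hv hvX hO
      obtain ⟨hvI, hv'⟩ := ρroot v hv
      obtain ⟨u, hu, hst, hd⟩ := h.hpar v s hv' hvX (Oout _ _ hvI hO)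
      refine ⟨u, Or.inl hu, hst, ?_⟩
      by_cases huI : u.1 ∈ I
      · rw [ρI _ huI]
        exact lt_of_le_of_lt (hb.dp _ huI) hd
      · rwa [ρn _ huI]
  · rw [Set.ssubset_iff_subset_ne]
    refine ⟨Set.subset_union_left, ?_⟩
    intro hEq
    obtain ⟨w, hw⟩ := hIne
    have hρw : ρ w ∈ I := hb.cl w (ρ w) hw (h.hρ w)
    have hall : ∀ s, (ρ w, s) ∈ O := by
      intro s; rw [hEq]; exact Or.inr hρw
    exact h.huniq (ρ w) true (h.hρ w) (hb.nX _ hρw) (hall _) (hall _)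

/-- extending a bad configuration towards the roots -/
theorem Bad.extend (sk : ∀ p q, st p q → st (bar q) (bar p)) (h : Str st X O ρ d)
    {I : Set V} {p q : V × Bool} (hb : Bad st X O ρ d I p q) (hne : ρ p.1 ≠ ρ q.1)
    (hd : d (ρ q.1) ≤ d (ρ p.1)) (hpX : ρ p.1 ∉ X) :
    ∃ I' p', Bad st X O ρ d I' p' q ∧ d (ρ p'.1) < d (ρ p.1) := by
  obtain ⟨c, a, c1, c2, c3, c4, c5, c6⟩ := h.hin p hb.hp
  set r := ρ p.1 with hr
  have hrr : ρ r = r := h.hρ _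
  obtain ⟨p', hp'O, hst, hdp⟩ := h.hpar r a hrr hpX c4
  obtain ⟨z, z1, z2, z3⟩ := hb.z
  have cI : ∀ u ∈ c, u.1 ∉ I := fun u hu huI =>
    hb.pI (hb.cl u.1 p.1 huI (by rw [c6 u hu]))
  have hclink : ∀ y ∈ c.head?, st p' y := by
    intro y hy
    rw [c3, Option.mem_some_iff] at hy
    subst hy; exact hst
  have hcz : List.IsChain st (c ++ (z ++ [bar q])) := by
    rw [List.isChain_append]
    rw [List.isChain_cons] at z1
    refine ⟨c1, z1.2, ?_⟩
    intro u hu y hy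
    rw [c5, Option.mem_some_iff] at hu
    subst hu
    exact z1.1 y hy
  have hcz2 : VN (c ++ z) := c2.app z2 (fun u hu v hv huv => cI u hu (huv ▸ z3 v hv))
  have hcz3 : ∀ w ∈ c ++ z, w.1 ∈ I ∪ {w | ρ w = r} := by
    intro w hw
    rcases List.mem_append.1 hw with hw | hw
    · exact Or.inr (c6 w hw)
    · exact Or.inl (z3 w hw)
  refine ⟨I ∪ {w | ρ w = r}, p', ?_, hdp⟩
  constructor
  · exact hp'O
  · exact hb.hq
  · rintro w w' (hw | hw) hww
    · exact Or.inl (hb.cl w w' hw hww)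
    · exact Or.inr (hww.trans hw)
  · rintro w (hw | hw)
    · exact hb.nX w hw
    · intro hwX
      have : ρ w = w := h.hXr w hwX
      rw [hw] at this
      exact hpX (this ▸ hwX)
  · rintro (hw | hw)
    · have h1 : d r ≤ d (ρ p'.1) := hb.dp _ hw
      omega
    · have : ρ p'.1 = r := hw
      rw [this] at hdp
      exact lt_irrefl _ hdp
  · rintro (hw | hw)
    · exact hb.qI hw
    · exact hne (Eq.symm hw)
  · rintro w (hw | hw)
    · exact hdp.le.trans (hb.dp w hw)
    · rw [show ρ w = r from hw]; exact hdp.le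
  · rintro w (hw | hw)
    · exact hb.dq w hw
    · rw [show ρ w = r from hw]; exact hd
  · refine ⟨c ++ z, ?_, hcz2, hcz3⟩
    rw [List.append_assoc, List.isChain_cons]
    refine ⟨?_, hcz⟩
    intro y hy
    apply hclink
    simpa [c3] using hy
  · rintro w (hw | hw) s
    · obtain ⟨l, l1, l2, l3, l4, l5⟩ := hb.rch w hw s
      rcases l5 with l5 | l5
      · refine ⟨c ++ l, ?_, ?_, ?_, ?_, Or.inl ?_⟩
        · rw [List.isChain_append]
          refine ⟨c1, l1, ?_⟩
          intro u hu y hy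
          rw [c5, Option.mem_some_iff] at hu
          subst hu
          exact l5 y hy
        · exact c2.app l2 (fun u hu v hv huv => cI u hu (huv ▸ l3 v hv))
        · intro u hu
          rcases List.mem_append.1 hu with hu | hu
          · exact Or.inr (c6 u hu)
          · exact Or.inl (l3 u hu)
        · simp [l4]
        · intro y hy
          apply hclink
          simpa [c3] using hy
      · exact ⟨l, l1, l2, fun u hu => Or.inl (l3 u hu), l4, Or.inr l5⟩
    · have hw : ρ w = r := hw
      by_cases hwr : w = r
      · rw [hwr]
        by_cases hs : s = a
        · rw [hs]
          refine ⟨[(r, a)], by simp, by simp [VN], ?_, by simp, Or.inl ?_⟩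
          · intro u hu
            rw [List.mem_singleton] at hu
            subst hu
            exact Or.inr hrr
          · simpa using hst
        · have hs' : s = !a := Bool.eq_not.2 hs
          have hch := chain_rv sk hcz
          have he : rv (c ++ (z ++ [bar q])) = q :: rv (c ++ z) := by
            simp [rv]
          rw [he, List.isChain_cons] at hch
          refine ⟨rv (c ++ z), hch.2, hcz2.rv, ?_, ?_, Or.inr hch.1⟩
          · intro u hu
            exact hcz3 (bar u) (mem_rv.1 hu)
          · rw [rv_last]
            simp [c3, bar, hs']
      · have hwO : (w, s) ∈ O := h.hout w (by rw [hw]; exact Ne.symm hwr) s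
        obtain ⟨l, t, l1, l2, l3, l4, l5, l6⟩ := h.hin _ hwO
        simp only [hw] at l3 l4 l6
        have : t = a := h.uniq hrr hpX l4 c4
        subst this
        refine ⟨l, l1, l2, fun u hu => Or.inr (l6 u hu), l5, Or.inl ?_⟩
        intro y hy
        rw [l3, Option.mem_some_iff] at hy
        subst hy; exact hst
  · right
    exact ⟨r, Or.inr hrr⟩

theorem improve (sk : ∀ p q, st p q → st (bar q) (bar p)) (h : Str st X O ρ d)
    (hXX : ∀ l : List (V × Bool), l.IsChain st → VN l → ∀ x y, l.head? = some x →
      l.getLast? = some y → x.1 ∈ X → y.1 ∈ X → x.1 = y.1) :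
    ∀ (n : ℕ) (I : Set V) (p q : V × Bool), Bad st X O ρ d I p q →
      d (ρ p.1) + d (ρ q.1) ≤ n → ∃ O' ρ', Str st X O' ρ' d ∧ O ⊂ O' := by
  intro n
  induction n using Nat.strong_induction_on with
  | _ n ih =>
  intro I p q hb hn
  by_cases heq : ρ p.1 = ρ q.1
  · exact merge h hb heq
  wlog hd : d (ρ q.1) ≤ d (ρ p.1) generalizing p q
  · exact this q p (hb.symm sk) (by omega) (Ne.symm heq) (by omega)
  by_cases hpX : ρ p.1 ∈ X
  · exfalso
    have hqX : ρ q.1 ∈ X := by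
      by_contra hqX
      obtain ⟨t, ht⟩ := h.rootO hb.hq
      obtain ⟨_, _, _, hlt⟩ := h.hpar _ t (h.hρ _) hqX ht
      rw [h.hXd _ hpX] at hd
      omega
    obtain ⟨c, a, c1, c2, c3, c4, c5, c6⟩ := h.hin p hb.hp
    obtain ⟨c', a', c1', c2', c3', c4', c5', c6'⟩ := h.hin q hb.hq
    obtain ⟨z, z1, z2, z3⟩ := hb.z
    have cI : ∀ u ∈ c, u.1 ∉ I := fun u hu huI =>
      hb.pI (hb.cl u.1 p.1 huI (by rw [c6 u hu]))
    have cI' : ∀ u ∈ c', u.1 ∉ I := fun u hu huI =>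
      hb.qI (hb.cl u.1 q.1 huI (by rw [c6' u hu]))
    rw [List.isChain_cons] at z1
    have z1' := List.isChain_append.1 z1.2
    refine heq (hXX (c ++ (z ++ rv c')) ?_ ?_ (ρ p.1, a) (bar (ρ q.1, a')) (by simp [c3])
      ?_ hpX hqX)
    · rw [List.isChain_append, List.isChain_append]
      refine ⟨c1, ⟨z1'.1, chain_rv sk c1', ?_⟩, ?_⟩
      · intro u hu y hy
        apply z1'.2.2 u hu
        rw [rv_head, c5'] at hy
        simpa using hy
      · intro u hu y hy
        rw [c5, Option.mem_some_iff] at hu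
        subst hu
        apply z1.1
        rw [List.head?_append, rv_head, c5'] at hy
        simpa using hy
    · refine c2.app (z2.app c2'.rv ?_) ?_
      · intro u hu v hv huv
        exact cI' _ (mem_rv.1 hv) (by simpa [← huv] using z3 u hu)
      · intro u hu v hv huv
        rcases List.mem_append.1 hv with hv | hv
        · exact cI u hu (huv ▸ z3 v hv)
        · have h1 := c6 u hu
          have h2 := c6' _ (mem_rv.1 hv)
          rw [bar_fst, ← huv, h1] at h2
          exact heq h2
    · rw [List.getLast?_append, List.getLast?_append, rv_last, c3']
      simp
  · obtain ⟨I', p', hb', hlt⟩ := hb.extend sk h heq hd hpX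
    exact ih _ (by omega) I' p' q hb' le_rfl

theorem grow (h : Str st X O ρ d) {p q : V × Bool} (hp : p ∈ O) (hst : st p q)
    (hq : ∀ s, (q.1, s) ∉ O) : ∃ O' d', Str st X O' ρ d' ∧ O ⊂ O' := by
  classical
  have hqr : ρ q.1 = q.1 := by
    by_contra hne
    exact hq true (h.hout _ hne _)
  have hqX : q.1 ∉ X := fun hX => hq true (h.hX _ hX _)
  have hρ : ∀ w ∈ O, ρ w.1 ≠ q.1 := by
    intro w hw he
    obtain ⟨t, ht⟩ := h.rootO hw
    rw [he] at ht
    exact hq _ ht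
  refine ⟨insert q O, fun v => if v = q.1 then d (ρ p.1) + 1 else d v, ?_, ?_⟩
  · constructor
    · intro x hx s; exact Or.inr (h.hX x hx s)
    · exact h.hXr
    · intro x hx
      have : x ≠ q.1 := by rintro rfl; exact hqX hx
      simp [this, h.hXd x hx]
    · exact h.hρ
    · intro v hv s; exact Or.inr (h.hout v hv s)
    · rintro v s hv hvX (h1 | h1) (h2 | h2)
      · rw [← h1] at h2
        simp at h2
      · rw [← h1] at hq; exact hq _ h2
      · rw [← h2] at hq; exact hq _ h1
      · exact h.huniq v s hv hvX h1 h2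
    · rintro w (rfl | hw)
      · refine ⟨[w], w.2, by simp, by simp [VN], by simp [hqr], by simp [hqr], by simp, by simp⟩
      · obtain ⟨l, t, l1, l2, l3, l4, l5, l6⟩ := h.hin w hw
        exact ⟨l, t, l1, l2, l3, Or.inr l4, l5, l6⟩
    · rintro r s hr hrX (h1 | h1)
      · refine ⟨p, Or.inr hp, h1 ▸ hst, ?_⟩
        have : r = q.1 := by rw [← h1]
        simp [this, hρ p hp]
      · obtain ⟨u, hu, hust, hud⟩ := h.hpar r s hr hrX h1
        refine ⟨u, Or.inr hu, hust, ?_⟩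
        have : r ≠ q.1 := by rintro rfl; exact hq _ h1
        simp [this, hρ u hu, hud]
  · exact Set.ssubset_insert (hq q.2)

theorem exists_closed [Finite V] (sk : ∀ p q, st p q → st (bar q) (bar p))
    (hXX : ∀ l : List (V × Bool), l.IsChain st → VN l → ∀ x y, l.head? = some x →
      l.getLast? = some y → x.1 ∈ X → y.1 ∈ X → x.1 = y.1) :
    ∃ O ρ d, Str st X O ρ d ∧ (∀ p q, p ∈ O → st p q → ∃ s, (q.1, s) ∈ O) ∧
      (∀ p q, p ∈ O → st p q → bar q ∈ O → ρ p.1 = ρ q.1) := by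
  have init : Str st X {p | p.1 ∈ X} id (fun _ => 0) := by
    constructor
    · intro x hx s; exact hx
    · intros; rfl
    · intros; rfl
    · intros; rfl
    · intro v hv; exact absurd rfl hv
    · intro v s _ h1 h2; exact absurd h2 h1
    · intro p hp
      exact ⟨[p], p.2, by simp, by simp [VN], by simp, hp, by simp, by simp⟩
    · intro r s _ h1 h2; exact absurd h2 h1
  have hfin : (Set.univ : Set (Set (V × Bool))).Finite := Set.toFinite _
  obtain ⟨O, hO⟩ := (Set.toFinite {O | ∃ ρ d, Str st X O ρ d}).exists_maximal
    ⟨_, id, _, init⟩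
  obtain ⟨⟨ρ, d, h⟩, hmax⟩ := hO
  have hmax' : ∀ O' ρ' d', Str st X O' ρ' d' → ¬ O ⊂ O' := by
    intro O' ρ' d' h' hss
    exact hss.2 (hmax ⟨ρ', d', h'⟩ hss.1)
  refine ⟨O, ρ, d, h, ?_, ?_⟩
  · intro p q hp hst
    by_contra hcon
    push Not at hcon
    obtain ⟨O', d', h', hss⟩ := grow h hp hst hcon
    exact hmax' _ _ _ h' hss
  · intro p q hp hst hq
    by_contra hne
    have hb : Bad st X O ρ d ∅ p (bar q) := by
      refine ⟨hp, hq, by simp, by simp, by simp, by simp, by simp, by simp,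
        ⟨[], by simpa using hst, by simp [VN], by simp⟩, by simp, Or.inl hne⟩
    obtain ⟨O', ρ', h', hss⟩ := improve sk h hXX _ _ _ _ hb le_rfl
    exact hmax' _ _ _ h' hss

theorem core [Fintype V] [DecidableEq V] (sk : ∀ p q, st p q → st (bar q) (bar p))
    (hXX : ∀ l : List (V × Bool), l.IsChain st → VN l → ∀ x y, l.head? = some x →
      l.getLast? = some y → x.1 ∈ X → y.1 ∈ X → x.1 = y.1) (Y : Set V) (k : ℕ)
    (hk : ∀ S : Finset V, (∀ l : List (V × Bool), l.IsChain st → VN l → ∀ x y, l.head? = some x →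
      l.getLast? = some y → x.1 ∈ X → y.1 ∈ Y → ∃ p ∈ l, p.1 ∈ S) → k ≤ S.card) :
    ∃ P : Fin k → List (V × Bool), (∀ i, (P i).IsChain st ∧ VN (P i) ∧
      (∃ x, (P i).head? = some x ∧ x.1 ∈ X) ∧ (∃ y, (P i).getLast? = some y ∧ y.1 ∈ Y)) ∧
      ∀ i j, i ≠ j → ∀ p ∈ P i, ∀ q ∈ P j, p.1 ≠ q.1 := by
  classical
  obtain ⟨O, ρ, d, h, hgrow, hbad⟩ := exists_closed (X := X) sk hXX
  let D : V → V → Prop := fun r r' => ρ r' = r' ∧ r' ∉ X ∧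
    ∃ q t, q ∈ O ∧ (r', t) ∈ O ∧ st q (r', t) ∧ ρ q.1 = r
  let F : Finset (V × V) := Finset.univ.filter (fun e => D e.1 e.2)
  have hF : ∀ u v, rel F u v ↔ D u v := by intro u v; simp [rel, F]
  let YD : Set V := {r | ∃ y ∈ Y, ∃ s, (y, s) ∈ O ∧ ρ y = r}
  -- projection
  have proj : ∀ l : List (V × Bool), l.IsChain st → VN l → (∃ x, l.head? = some x ∧ x.1 ∈ X) →
      ∀ p, l.getLast? = some p → p ∈ O ∧ ∃ L : List V, L.IsChain (rel F) ∧
        (∃ a ∈ X, L.head? = some a) ∧ L.getLast? = some (ρ p.1) ∧ ∀ v ∈ L, ∃ w ∈ l, w.1 = v := by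
    intro l
    induction l using List.reverseRecOn with
    | nil => intro _ _ _ p hp; simp at hp
    | append_singleton l q ih =>
      intro hc hn hh p hp
      have : q = p := by simpa using hp
      subst this
      rcases List.eq_nil_or_concat' l with rfl | ⟨l', u, rfl⟩
      · obtain ⟨x, hx, hxX⟩ := hh
        have : q = x := by simpa using hx
        subst this
        refine ⟨h.hX _ hxX _, [q.1], by simp, ⟨q.1, hxX, by simp⟩, by simp [h.hXr _ hxX], by simp⟩
      · have hc' := List.isChain_append.1 hc
        have hn' : VN (l' ++ [u]) ∧ ∀ w ∈ l' ++ [u], w.1 ≠ q.1 := by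
          unfold VN at hn ⊢
          rw [List.map_append, List.nodup_append] at hn
          refine ⟨hn.1, fun w hw => ?_⟩
          exact hn.2.2 w.1 (List.mem_map_of_mem hw) q.1 (by simp)
        obtain ⟨huO, L, L1, L2, L3, L4⟩ := ih hc'.1 hn'.1 (by
          obtain ⟨x, hx, hxX⟩ := hh
          refine ⟨x, ?_, hxX⟩
          cases l' <;> simpa using hx) u (by simp)
        have hst : st u q := hc'.2.2 u (by simp) q (by simp)
        have hL4 : ∀ v ∈ L, ∃ w ∈ (l' ++ [u]) ++ [q], w.1 = v := by
          intro v hv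
          obtain ⟨w, hw, hwv⟩ := L4 v hv
          exact ⟨w, List.mem_append_left _ hw, hwv⟩
        by_cases hρ : ρ u.1 = ρ q.1
        · have hq : ρ q.1 ≠ q.1 := by
            intro hq
            obtain ⟨w, hw, hwv⟩ := L4 (ρ u.1) (List.mem_of_getLast? L3)
            exact hn'.2 w hw (by rw [hwv, hρ, hq])
          exact ⟨h.hout _ hq _, L, L1, L2, by rw [L3, hρ], hL4⟩
        · have hbq : bar q ∉ O := fun hb => hρ (hbad u q huO hst hb)
          obtain ⟨s, hs⟩ := hgrow u q huO hst
          have hqO : q ∈ O := by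
            by_cases hsq : s = q.2
            · subst hsq; exact hs
            · exfalso; apply hbq
              have : s = !q.2 := Bool.eq_not.2 hsq
              rw [this] at hs; exact hs
          have hq : ρ q.1 = q.1 := by
            by_contra hne; exact hbq (h.hout _ hne _)
          have hqX : q.1 ∉ X := fun hX => hbq (h.hX _ hX _)
          refine ⟨hqO, L ++ [q.1], ?_, ?_, by simp [hq], ?_⟩
          · rw [List.isChain_append]
            refine ⟨L1, by simp, ?_⟩
            intro a ha b hb
            rw [L3, Option.mem_some_iff] at ha
            subst ha
            have : q.1 = b := by simpa using hb
            subst this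
            rw [hF]
            exact ⟨hq, hqX, u, q.2, huO, hqO, hst, rfl⟩
          · obtain ⟨a, ha, hLa⟩ := L2
            exact ⟨a, ha, by simp [hLa]⟩
          · intro v hv
            rcases List.mem_append.1 hv with hv | hv
            · exact hL4 v hv
            · rw [List.mem_singleton] at hv
              exact ⟨q, by simp, hv.symm⟩
  -- lifting
  have lift : ∀ L : List V, L.IsChain (rel F) → L.Nodup → (∃ a ∈ X, L.head? = some a) →
      ∀ p ∈ O, L.getLast? = some (ρ p.1) → ∃ l : List (V × Bool), l.IsChain st ∧ VN l ∧
        (∃ x, l.head? = some x ∧ x.1 ∈ X) ∧ l.getLast? = some p ∧ ∀ w ∈ l, ρ w.1 ∈ L := by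
    intro L
    induction L using List.reverseRecOn with
    | nil => intro _ _ _ p _ hp; simp at hp
    | append_singleton L r ih =>
      intro hc hn hh p hpO hp
      have hpr : r = ρ p.1 := by simpa using hp
      obtain ⟨l, t, l1, l2, l3, l4, l5, l6⟩ := h.hin p hpO
      rw [← hpr] at l3 l4 l6
      rcases List.eq_nil_or_concat' L with rfl | ⟨L', r', rfl⟩
      · obtain ⟨x, hxX, hx⟩ := hh
        have : r = x := by simpa using hx
        subst this
        exact ⟨l, l1, l2, ⟨_, l3, hxX⟩, l5, by simpa using l6⟩
      · have hc' := List.isChain_append.1 hc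
        have hn' := List.nodup_append.1 hn
        have hD := hc'.2.2 r' (by simp) r (by simp)
        rw [hF] at hD
        obtain ⟨hrr, hrX, q, t', hqO, hrO, hst, hqr⟩ := hD
        have : t = t' := h.uniq hrr hrX l4 hrO
        subst this
        obtain ⟨m, m1, m2, m3, m4, m5⟩ := ih hc'.1 hn'.1 (by
          obtain ⟨x, hxX, hx⟩ := hh
          refine ⟨x, hxX, ?_⟩
          cases L' <;> simpa using hx) q hqO (by simp [hqr])
        refine ⟨m ++ l, ?_, ?_, ?_, by simp [l5], ?_⟩
        · rw [List.isChain_append]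
          refine ⟨m1, l1, ?_⟩
          intro a ha b hb
          rw [m4, Option.mem_some_iff] at ha
          rw [l3, Option.mem_some_iff] at hb
          subst ha; subst hb; exact hst
        · refine m2.app l2 ?_
          intro u hu v hv huv
          exact hn'.2.2 _ (m5 u hu) r (by simp) (by rw [huv, l6 v hv])
        · obtain ⟨x, hx, hxX⟩ := m3
          exact ⟨x, by simp [hx], hxX⟩
        · intro w hw
          rcases List.mem_append.1 hw with hw | hw
          · exact List.mem_append_left _ (m5 w hw)
          · rw [l6 w hw]; simp
  obtain ⟨P, Pc, Pn, Ph, Pl, Pd⟩ := menger_dir F X YD k (by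
    intro S hS
    apply hk
    intro l hc hn x y hx hy hxX hyY
    obtain ⟨hyO, L, L1, L2, L3, L4⟩ := proj l hc hn ⟨x, hx, hxX⟩ y hy
    obtain ⟨v, hv, hvS⟩ := hS L L1 L2 ⟨ρ y.1, ⟨y.1, hyY, y.2, hyO, rfl⟩, L3⟩
    obtain ⟨w, hw, rfl⟩ := L4 v hv
    exact ⟨w, hw, hvS⟩)
  have : ∀ i, ∃ l : List (V × Bool), l.IsChain st ∧ VN l ∧
      (∃ x, l.head? = some x ∧ x.1 ∈ X) ∧ (∃ y, l.getLast? = some y ∧ y.1 ∈ Y) ∧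
      ∀ w ∈ l, ρ w.1 ∈ P i := by
    intro i
    obtain ⟨b, ⟨y, hyY, s, hyO, rfl⟩, hb⟩ := Pl i
    obtain ⟨l, l1, l2, l3, l4, l5⟩ := lift (P i) (Pc i) (Pn i) (Ph i) (y, s) hyO hb
    exact ⟨l, l1, l2, l3, ⟨_, l4, hyY⟩, l5⟩
  choose R R1 R2 R3 R4 R5 using this
  refine ⟨R, fun i => ⟨R1 i, R2 i, R3 i, R4 i⟩, ?_⟩
  intro i j hij p hp q hq hpq
  exact Pd i j hij (R5 i p hp) (hpq ▸ R5 j q hq)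

end

section
variable {V E : Type} (B : BidirGraph V E)

def stp (p q : V × Bool) : Prop :=
  ∃ e d, B.tl e d = p.1 ∧ B.tlSgn e d = p.2 ∧ B.hd e d = q.1 ∧ B.hdSgn e d = !q.2

theorem stp_skew (p q : V × Bool) (h : stp B p q) : stp B (bar q) (bar p) := by
  obtain ⟨e, d, h1, h2, h3, h4⟩ := h
  refine ⟨e, !d, ?_, ?_, ?_, ?_⟩ <;>
    cases d <;> simp_all [bar, BidirGraph.tl, BidirGraph.hd, BidirGraph.tlSgn, BidirGraph.hdSgn]

theorem walk_to_list {n : ℕ} (W : B.Walk n) :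
    ∃ l : List (V × Bool), l.IsChain (stp B) ∧ l.map Prod.fst = List.ofFn W.vert := by
  let f : Fin (n + 1) → Bool := fun i =>
    if h : (i : ℕ) < n then B.tlSgn (W.edge ⟨i, h⟩) (W.dir ⟨i, h⟩)
    else if h : 0 < n then !B.hdSgn (W.edge ⟨n - 1, by omega⟩) (W.dir ⟨n - 1, by omega⟩)
    else true
  refine ⟨List.ofFn (fun i => (W.vert i, f i)), ?_, ?_⟩
  · rw [List.isChain_iff_getElem]
    intro i hi
    rw [List.length_ofFn] at hi
    have hin : i < n := by omega
    simp only [List.getElem_ofFn]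
    refine ⟨W.edge ⟨i, hin⟩, W.dir ⟨i, hin⟩, W.tail_eq ⟨i, hin⟩, ?_, W.head_eq ⟨i, hin⟩, ?_⟩
    · simp [f, hin]
    · by_cases h2 : i + 1 < n
      · have := W.sign_alt ⟨i, hin⟩ ⟨i + 1, h2⟩ rfl
        simp only [f, h2, dif_pos]
        exact Bool.eq_not.2 this
      · have : i = n - 1 := by omega
        subst this
        have h0 : 0 < n := by omega
        simp [f, h2, h0]
  · rw [List.map_ofFn]; rfl

theorem list_to_walk (l : List (V × Bool)) (hl : l ≠ []) (hc : l.IsChain (stp B)) :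
    ∃ (n : ℕ) (W : B.Walk n), l.map Prod.fst = List.ofFn W.vert := by
  obtain ⟨n, hn⟩ : ∃ n, l.length = n + 1 :=
    ⟨l.length - 1, by have := List.length_pos_iff.2 hl; omega⟩
  rw [List.isChain_iff_getElem] at hc
  have hc' : ∀ i : Fin n, stp B (l[(i : ℕ)]'(by omega)) (l[(i : ℕ) + 1]'(by omega)) :=
    fun i => hc i (by omega)
  choose e d h1 h2 h3 h4 using hc'
  refine ⟨n, ⟨fun i => (l[(i : ℕ)]'(by omega)).1, e, d, ?_, ?_, ?_⟩, ?_⟩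
  · intro i; exact h1 i
  · intro i; exact h3 i
  · intro i j hij
    rw [h4, h2]
    have : l[(i : ℕ) + 1]'(by omega) = l[(j : ℕ)]'(by omega) := by congr 1
    rw [this]; simp
  · apply List.ext_getElem
    · simp [hn]
    · intro i _ _
      rw [List.getElem_map, List.getElem_ofFn]

theorem head_of {n : ℕ} {W : B.Walk n} {l : List (V × Bool)}
    (h : l.map Prod.fst = List.ofFn W.vert) {x : V × Bool} (hx : l.head? = some x) :
    W.vert 0 = x.1 := by
  have : (l.map Prod.fst).head? = some x.1 := by simp [hx]
  rw [h, List.ofFn_succ] at this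
  simpa using this

theorem last_of {n : ℕ} {W : B.Walk n} {l : List (V × Bool)}
    (h : l.map Prod.fst = List.ofFn W.vert) {x : V × Bool} (hx : l.getLast? = some x) :
    W.vert (Fin.last n) = x.1 := by
  have : (l.map Prod.fst).getLast? = some x.1 := by simp [hx]
  rw [h, List.ofFn_succ_last] at this
  simpa using this

theorem path_of {n : ℕ} {W : B.Walk n} {l : List (V × Bool)}
    (h : l.map Prod.fst = List.ofFn W.vert) : VN l ↔ W.IsPath := by
  unfold VN BidirGraph.Walk.IsPath
  rw [h, List.nodup_ofFn]

theorem mem_of {n : ℕ} {W : B.Walk n} {l : List (V × Bool)}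
    (h : l.map Prod.fst = List.ofFn W.vert) (v : V) : (∃ p ∈ l, p.1 = v) ↔ ∃ i, W.vert i = v := by
  rw [← List.mem_map, h, List.mem_ofFn]

theorem reverse_walk {n : ℕ} (W : B.Walk n) : ∃ W' : B.Walk n, ∀ i, W'.vert i = W.vert i.rev := by
  obtain ⟨l, hc, hl⟩ := walk_to_list B W
  have hlen : l.length = n + 1 := by simpa using congrArg List.length hl
  obtain ⟨m, W', h'⟩ := list_to_walk B (rv l) (by
    intro h0
    have := congrArg List.length h0
    simp [rv, hlen] at this) (chain_rv (stp_skew B) hc)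
  have e1 : (rv l).map Prod.fst = (l.map Prod.fst).reverse := by
    unfold rv
    rw [List.map_reverse, List.map_map]; rfl
  have hm : m = n := by
    have := congrArg List.length h'
    simp [rv, hlen] at this; omega
  subst hm
  rw [e1, hl] at h'
  refine ⟨W', fun i => ?_⟩
  have h2 : (List.ofFn W.vert).reverse[(i : ℕ)]'(by
      rw [List.length_reverse, List.length_ofFn]; exact i.2) =
      (List.ofFn W'.vert)[(i : ℕ)]'(by rw [List.length_ofFn]; exact i.2) := by
    simp only [h']
  simp only [List.getElem_reverse, List.getElem_ofFn, List.length_ofFn] at h2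
  rw [← h2]
  congr 1
  ext
  simp [Fin.val_rev]

def Fam (X Y : Set V) (k : ℕ) : Prop :=
  ∃ (n : Fin k → ℕ) (P : ∀ i, B.Walk (n i)),
        (∀ i, (P i).IsPath) ∧ (∀ i, (P i).vert 0 ∈ X) ∧
        (∀ i, (P i).vert (Fin.last (n i)) ∈ Y) ∧
        (∀ i j, i ≠ j → Disjoint (P i).verts (P j).verts)

theorem rev_props {n : ℕ} {W W' : B.Walk n} (h : ∀ i, W'.vert i = W.vert i.rev) :
    (W.IsPath → W'.IsPath) ∧ W'.verts = W.verts ∧ W'.vert 0 = W.vert (Fin.last n) ∧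
      W'.vert (Fin.last n) = W.vert 0 := by
  have hf : W'.vert = W.vert ∘ Fin.rev := funext h
  refine ⟨?_, ?_, ?_, ?_⟩
  · intro hp
    unfold BidirGraph.Walk.IsPath at *
    rw [hf]
    exact hp.comp Fin.rev_injective
  · unfold BidirGraph.Walk.verts
    rw [hf]
    exact Fin.rev_surjective.range_comp _
  · rw [h]; simp
  · rw [h]; simp

theorem Fam.swap {X Y : Set V} {k : ℕ} (h : Fam B X Y k) : Fam B Y X k := by
  obtain ⟨n, P, h1, h2, h3, h4⟩ := h
  choose Q hQ using fun i => reverse_walk B (P i)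
  have hp := fun i => rev_props B (hQ i)
  refine ⟨n, Q, fun i => (hp i).1 (h1 i), fun i => ?_, fun i => ?_, fun i j hij => ?_⟩
  · rw [(hp i).2.2.1]; exact h3 i
  · rw [(hp i).2.2.2]; exact h2 i
  · rw [(hp i).2.1, (hp j).2.1]; exact h4 i j hij

theorem epa_swap {X Y S : Set V} (h : B.ExistsPathAvoiding X Y S) :
    B.ExistsPathAvoiding Y X S := by
  obtain ⟨n, W, h1, h2, h3, h4⟩ := h
  obtain ⟨W', hW⟩ := reverse_walk B W
  have hp := rev_props B hW
  refine ⟨n, W', hp.1 h1, ?_, ?_, fun i => ?_⟩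
  · rw [hp.2.2.1]; exact h3
  · rw [hp.2.2.2]; exact h2
  · rw [hW]; exact h4 _

theorem fam_of [Fintype V] [DecidableEq V] {X Y : Set V} (h : ¬ B.ExistsNontrivialPath X X) (k : ℕ)
    (hk : ∀ S : Finset V, ¬ B.ExistsPathAvoiding X Y ↑S → k ≤ S.card) : Fam B X Y k := by
  have hne : ∀ {l : List (V × Bool)} {x}, l.head? = some x → l ≠ [] := by
    rintro l x hx rfl; simp at hx
  obtain ⟨P, hP, hd⟩ := core (X := X) (stp_skew B) (by
    intro l hc hn x y hx hy hxX hyX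
    by_contra hxy
    obtain ⟨n, W, hW⟩ := list_to_walk B l (hne hx) hc
    have e1 := head_of B hW hx
    have e2 := last_of B hW hy
    refine h ⟨n, ?_, W, (path_of B hW).1 hn, by rw [e1]; exact hxX, by rw [e2]; exact hyX⟩
    rcases Nat.eq_zero_or_pos n with rfl | hn0
    · exact absurd (e1.symm.trans e2) hxy
    · exact hn0) Y k (by
    intro S hS
    apply hk
    rintro ⟨n, W, h1, h2, h3, h4⟩
    obtain ⟨l, hc, hW⟩ := walk_to_list B W
    have hl : l ≠ [] := by rintro rfl; simp at hW
    have hx := List.head?_eq_some_head hl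
    have hy := List.getLast?_eq_some_getLast hl
    obtain ⟨p, hp, hpS⟩ := hS l hc ((path_of B hW).2 h1) _ _ hx hy
      (by rw [← head_of B hW hx]; exact h2) (by rw [← last_of B hW hy]; exact h3)
    obtain ⟨i, hi⟩ := (mem_of B hW p.1).1 ⟨p, hp, rfl⟩
    exact h4 i (by rw [hi]; exact hpS))
  have : ∀ i, ∃ (n : ℕ) (W : B.Walk n), (P i).map Prod.fst = List.ofFn W.vert := by
    intro i
    obtain ⟨hc, _, ⟨x, hx, _⟩, _⟩ := hP i
    exact list_to_walk B _ (hne hx) hc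
  choose n W hW using this
  refine ⟨n, W, fun i => (path_of B (hW i)).1 (hP i).2.1, fun i => ?_, fun i => ?_, ?_⟩
  · obtain ⟨x, hx, hxX⟩ := (hP i).2.2.1
    rw [head_of B (hW i) hx]; exact hxX
  · obtain ⟨x, hx, hxX⟩ := (hP i).2.2.2
    rw [last_of B (hW i) hx]; exact hxX
  · intro i j hij
    rw [Set.disjoint_left]
    rintro v hv1 hv2
    obtain ⟨p, hp, hpv⟩ := (mem_of B (hW i) v).2 hv1
    obtain ⟨q, hq, hqv⟩ := (mem_of B (hW j) v).2 hv2
    exact hd i j hij p hp q hq (hpv.trans hqv.symm)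

theorem fam_le [DecidableEq V] {X Y : Set V} {k : ℕ} (hf : Fam B X Y k) (S : Finset V)
    (hS : ¬ B.ExistsPathAvoiding X Y ↑S) : k ≤ S.card := by
  obtain ⟨n, P, h1, h2, h3, h4⟩ := hf
  have : ∀ i, ∃ v ∈ S, v ∈ (P i).verts := by
    intro i
    by_contra hcon
    push Not at hcon
    exact hS ⟨n i, P i, h1 i, h2 i, h3 i, fun j hj => hcon _ hj ⟨j, rfl⟩⟩
  choose v hvS hv using this
  have inj : Function.Injective v := by
    intro i j hij
    by_contra hne
    exact Set.disjoint_left.1 (h4 i j hne) (hv i) (hij ▸ hv j)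
  have := Finset.card_le_card_of_injOn (s := Finset.univ) (t := S) v (fun i _ => hvS i)
    inj.injOn
  simpa using this

end

end BidirProof


theorem menger_bidirected {V E : Type} [Fintype V] [DecidableEq V] [Fintype E]
    (B : BidirGraph V E) (X Y : Set V)
    (h : ¬ B.ExistsNontrivialPath X X ∨ ¬ B.ExistsNontrivialPath Y Y) :
    sSup {k : ℕ | ∃ (n : Fin k → ℕ) (P : ∀ i, B.Walk (n i)),
        (∀ i, (P i).IsPath) ∧ (∀ i, (P i).vert 0 ∈ X) ∧
        (∀ i, (P i).vert (Fin.last (n i)) ∈ Y) ∧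
        (∀ i j, i ≠ j → Disjoint (P i).verts (P j).verts)} =
      sInf {k : ℕ | ∃ S : Finset V, S.card = k ∧ ¬ B.ExistsPathAvoiding X Y ↑S} := by
  have hne : {k : ℕ | ∃ S : Finset V, S.card = k ∧ ¬ B.ExistsPathAvoiding X Y ↑S}.Nonempty := by
    refine ⟨_, Finset.univ, rfl, ?_⟩
    rintro ⟨n, W, _, _, _, h4⟩
    exact h4 0 (by simp)
  obtain ⟨S, hS, hSs⟩ := Nat.sInf_mem hne
  have hmin : ∀ T : Finset V, ¬ B.ExistsPathAvoiding X Y ↑T →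
      sInf {k : ℕ | ∃ S : Finset V, S.card = k ∧ ¬ B.ExistsPathAvoiding X Y ↑S} ≤ T.card :=
    fun T hT => Nat.sInf_le ⟨T, rfl, hT⟩
  have hfam : BidirProof.Fam B X Y
      (sInf {k : ℕ | ∃ S : Finset V, S.card = k ∧ ¬ B.ExistsPathAvoiding X Y ↑S}) := by
    rcases h with h | h
    · exact BidirProof.fam_of B h _ hmin
    · exact (BidirProof.fam_of B h _
        (fun T hT => hmin T (fun h' => hT (BidirProof.epa_swap B h')))).swap
  apply IsGreatest.csSup_eq
  refine ⟨hfam, ?_⟩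
  intro k hk
  rw [← hS]
  exact BidirProof.fam_le B hk S hSs
end

section
/- Let B be a bidirected graph, and let X be a set of vertices of B. Then twice the maximum number of pairwise vertex-disjoint X-paths in B is greater than or equal to the minimum size of a set S of vertices of B such that B − S contains no X-path. -/
open BidirGraph


namespace BXP
theorem tutte_aux {N : Type} [Fintype N] (G : SimpleGraph N) (he : Even (Fintype.card N))
    (h : ¬ ∃ M : G.Subgraph, M.IsPerfectMatching) :
    ∃ (U : Set N) (K : Set (Set N)), U.ncard + 2 ≤ K.ncard ∧
      (∀ C ∈ K, Odd C.ncard ∧ Disjoint C U ∧ ∀ a ∈ C, ∀ b, b ∉ U → G.Adj a b → b ∈ C) ∧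
      (∀ C ∈ K, ∀ C' ∈ K, ∀ a, a ∈ C → a ∈ C' → C = C') := by
  classical
  rw [SimpleGraph.tutte] at h
  push Not at h
  obtain ⟨U, hU⟩ := h
  unfold SimpleGraph.IsTutteViolator at hU
  set H := ((⊤ : G.Subgraph).deleteVerts U).coe with hH
  have hpar := SimpleGraph.odd_ncard_oddComponents (G := H)
  have hcard : Nat.card ((⊤ : G.Subgraph).deleteVerts U).verts + U.ncard = Fintype.card N := by
    rw [Nat.card_coe_set_eq]
    have : ((⊤ : G.Subgraph).deleteVerts U).verts = Uᶜ := by ext; simp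
    rw [this, add_comm, Set.ncard_add_ncard_compl, Nat.card_eq_fintype_card]
  let f : H.ConnectedComponent → Set N := fun C => Subtype.val '' C.supp
  have hf : Function.Injective f := by
    intro C C' hCC
    have := Set.image_injective.2 Subtype.val_injective hCC
    exact SimpleGraph.ConnectedComponent.supp_injective this
  refine ⟨U, f '' H.oddComponents, ?_, ?_, ?_⟩
  · rw [Set.ncard_image_of_injective _ hf]
    rw [← hcard] at he
    rcases Nat.lt_or_ge (U.ncard + 1) H.oddComponents.ncard with h1 | h1
    · omega
    · exfalso
      have h2 : H.oddComponents.ncard = U.ncard + 1 := by omega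
      rw [h2] at hpar
      grind
  · rintro _ ⟨C, hC, rfl⟩
    refine ⟨?_, ?_, ?_⟩
    · rw [Set.ncard_image_of_injective _ Subtype.val_injective]
      exact hC
    · rw [Set.disjoint_left]
      rintro _ ⟨a, ha, rfl⟩
      have := a.2
      simp at this
      exact this
    · rintro _ ⟨a, ha, rfl⟩ b hb hab
      refine ⟨⟨b, by simpa using hb⟩, ?_, rfl⟩
      refine SimpleGraph.ConnectedComponent.mem_supp_of_adj_mem_supp C ha ?_
      have := a.2
      simp at this
      simp [hH, this, hb, hab]
  · rintro _ ⟨C, hC, rfl⟩ _ ⟨C', hC', rfl⟩ a ⟨a1, h1, rfl⟩ ⟨a2, h2, h3⟩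
    have := Subtype.ext h3
    subst this
    rw [SimpleGraph.ConnectedComponent.mem_supp_iff] at h1 h2
    rw [← h1, ← h2]

section orb
variable {N : Type} (M P : Equiv.Perm N)

theorem orb_conj (hM : ∀ a, M (M a) = a) (hP : ∀ a, P (P a) = a) (n : ℤ) (a : N) :
    M (((P * M) ^ n) a) = ((P * M) ^ (-n)) (M a) := by
  have hM' : M⁻¹ = M := by
    ext a; rw [Equiv.Perm.inv_eq_iff_eq]; exact (hM a).symm
  have hP' : P⁻¹ = P := by
    ext a; rw [Equiv.Perm.inv_eq_iff_eq]; exact (hP a).symm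
  have h1 : M * (P * M) * M⁻¹ = (P * M)⁻¹ := by
    rw [mul_inv_rev, hM', hP']; ext a; simp [hM]
  have h2 : M * (P * M) ^ n * M⁻¹ = (P * M) ^ (-n) := by
    rw [← conj_zpow, h1, inv_zpow, zpow_neg]
  rw [← h2]; simp

theorem orb_L1 (hM : ∀ a, M (M a) = a) (hP : ∀ a, P (P a) = a) (hne : ∀ a, P a ≠ a)
    (x : N) (hx : M x = x) (n : ℤ) (h : ((P * M) ^ n) x = x) :
    ∃ r : ℤ, n = 2 * r ∧ M (((P * M) ^ r) x) = ((P * M) ^ r) x := by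
  rcases Int.even_or_odd' n with ⟨r, hr | hr⟩
  · refine ⟨r, hr, ?_⟩
    rw [orb_conj M P hM hP, hx]
    conv_lhs => rw [← h, ← Equiv.Perm.mul_apply, ← zpow_add]
    congr 2; omega
  · exfalso
    apply hne (M (((P * M) ^ r) x))
    rw [← Equiv.Perm.mul_apply P M, ← Equiv.Perm.mul_apply, ← zpow_one_add]
    rw [orb_conj M P hM hP, hx]
    conv_rhs => rw [← h, ← Equiv.Perm.mul_apply, ← zpow_add]
    congr 2; omega

noncomputable def olen (x : N) : ℕ := sInf {i : ℕ | 0 < i ∧ M (((P * M) ^ i) x) = ((P * M) ^ i) x}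
noncomputable def ofin (x : N) : N := ((P * M) ^ (olen M P x)) x

theorem olen_spec [Finite N] (x : N) (hx : M x = x) : 0 < olen M P x ∧ M (ofin M P x) = ofin M P x := by
  have : (olen M P x) ∈ {i : ℕ | 0 < i ∧ M (((P * M) ^ i) x) = ((P * M) ^ i) x} := by
    apply Nat.sInf_mem
    refine ⟨orderOf (P * M), orderOf_pos _, ?_⟩
    rw [pow_orderOf_eq_one]; simpa using hx
  exact this

theorem olen_min (x : N) (i : ℕ) (h0 : 0 < i) (h : i < olen M P x) :
    M (((P * M) ^ i) x) ≠ ((P * M) ^ i) x := fun h1 => Nat.notMem_of_lt_sInf h ⟨h0, h1⟩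

theorem olen_minz (x : N) (i : ℤ) (h0 : 0 < i) (h : i < olen M P x) :
    M (((P * M) ^ i) x) ≠ ((P * M) ^ i) x := by
  obtain ⟨k, rfl⟩ := Int.eq_ofNat_of_zero_le h0.le
  have := olen_min M P x k (by omega) (by omega)
  simpa using this

theorem orb_L2a (hM : ∀ a, M (M a) = a) (hP : ∀ a, P (P a) = a) (hne : ∀ a, P a ≠ a)
    (x : N) (hx : M x = x) (n : ℤ) (h0 : 0 < n) (h1 : n < 2 * olen M P x) :
    ((P * M) ^ n) x ≠ x := by
  intro h
  obtain ⟨r, hr, h2⟩ := orb_L1 M P hM hP hne x hx n h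
  exact olen_minz M P x r (by omega) (by omega) h2

theorem orb_link1 (x y : N) (j l : ℤ) (h : ((P * M) ^ j) x = ((P * M) ^ l) y) :
    ((P * M) ^ (l - j)) y = x := by
  rw [sub_eq_neg_add, zpow_add, Equiv.Perm.mul_apply, ← h, ← Equiv.Perm.mul_apply, ← zpow_add]; simp

theorem orb_link2 (hM : ∀ a, M (M a) = a) (hP : ∀ a, P (P a) = a)
    (x y : N) (hy : M y = y) (j l : ℤ) (h : ((P * M) ^ j) x = M (((P * M) ^ l) y)) :
    ((P * M) ^ (- l - j)) y = x := by
  rw [orb_conj M P hM hP, hy] at h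
  exact orb_link1 M P x y j (-l) h

theorem orb_L2 (hM : ∀ a, M (M a) = a) (hP : ∀ a, P (P a) = a) (hne : ∀ a, P a ≠ a)
    (x : N) (hx : M x = x) (j l : ℕ) (hjl : j < l) (hl : l ≤ olen M P x) :
    ((P * M) ^ j) x ≠ ((P * M) ^ l) x ∧ ((P * M) ^ j) x ≠ M (((P * M) ^ l) x) := by
  constructor
  · intro h
    have := orb_link1 M P x x j l (by simpa using h)
    exact orb_L2a M P hM hP hne x hx _ (by omega) (by omega) this
  · intro h
    have := orb_link2 M P hM hP x x hx j l (by simpa using h)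
    refine orb_L2a M P hM hP hne x hx (l + j) (by omega) (by omega) ?_
    have h3 := orb_link1 M P x x (-l-j) 0 (by simpa using this)
    convert h3 using 3; omega

theorem orb_L3 [Finite N] (hM : ∀ a, M (M a) = a) (hP : ∀ a, P (P a) = a)
    (x y : N) (hx : M x = x) (hy : M y = y) (n : ℤ) (h : ((P * M) ^ n) y = x) :
    x = y ∨ x = ofin M P y := by
  obtain ⟨hpos, hfin⟩ := olen_spec M P y hy
  obtain ⟨i, hi⟩ : ∃ i : ℤ, i = olen M P y := ⟨_, rfl⟩
  have hfin' : M (((P * M) ^ i) y) = ((P * M) ^ i) y := by simpa [hi, ofin] using hfin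
  have hper : ((P * M) ^ (2 * i)) y = y := by
    have := orb_link2 M P hM hP y y hy i i hfin'.symm
    have h3 := orb_link1 M P y y (-i-i) 0 (by simpa using this)
    convert h3 using 3; omega
  have hperq : ∀ q : ℤ, ((P * M) ^ (2 * i * q)) y = y := by
    intro q; rw [zpow_mul]; exact Equiv.Perm.zpow_apply_eq_self_of_apply_eq_self hper q
  have hr : ((P * M) ^ (n % (2 * i))) y = x := by
    rw [← h]
    conv_rhs => rw [← Int.emod_add_mul_ediv n (2 * i), zpow_add, Equiv.Perm.mul_apply, hperq]
  have h0 := Int.emod_nonneg n (b := 2 * i) (by omega)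
  have h1 := Int.emod_lt_of_pos n (b := 2 * i) (by omega)
  generalize n % (2 * i) = r at *
  rcases h0.eq_or_lt with h2 | h2
  · left; subst h2; simpa using hr.symm
  rcases lt_trichotomy r i with h3 | h3 | h3
  · exfalso; apply olen_minz M P y r h2 (by omega); rw [hr, hx]
  · right; rw [← hr, h3]; simp [hi, ofin]
  · exfalso
    apply olen_minz M P y (2 * i - r) (by omega) (by omega)
    have h5 : ((P * M) ^ (2 * i - r)) y = x := by
      rw [← hr] at hx
      rw [orb_conj M P hM hP, hy] at hx
      rw [sub_eq_neg_add, zpow_add, Equiv.Perm.mul_apply, hper, hx, hr]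
    rw [h5, hx]

theorem ofin_ne [Finite N] (hM : ∀ a, M (M a) = a) (hP : ∀ a, P (P a) = a) (hne : ∀ a, P a ≠ a)
    (x : N) (hx : M x = x) : ofin M P x ≠ x := by
  have := (orb_L2 M P hM hP hne x hx 0 (olen M P x) (olen_spec M P x hx).1 le_rfl).1
  exact fun h => this (by simpa [ofin] using h.symm)

theorem ofin_ofin [Finite N] (hM : ∀ a, M (M a) = a) (hP : ∀ a, P (P a) = a) (hne : ∀ a, P a ≠ a)
    (x : N) (hx : M x = x) : ofin M P (ofin M P x) = x := by
  rcases orb_L3 M P hM hP x (ofin M P x) hx (olen_spec M P x hx).2 (-(olen M P x : ℤ))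
    (by simp [ofin]) with h | h
  · exact absurd h.symm (ofin_ne M P hM hP hne x hx)
  · exact h.symm

theorem orb_disj [Finite N] (hM : ∀ a, M (M a) = a) (hP : ∀ a, P (P a) = a)
    (x y : N) (hx : M x = x) (hy : M y = y) (j l : ℕ)
    (h : ((P * M) ^ j) x = ((P * M) ^ l) y ∨ ((P * M) ^ j) x = M (((P * M) ^ l) y)) :
    x = y ∨ x = ofin M P y := by
  rcases h with h | h
  · exact orb_L3 M P hM hP x y hx hy _ (orb_link1 M P x y j l (by simpa using h))
  · exact orb_L3 M P hM hP x y hx hy _ (orb_link2 M P hM hP x y hy j l (by simpa using h))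

end orb

section nodes
variable {V E : Type}

abbrev Nd (X : Set V) (m : ℕ) : Type := (↥X ⊕ Fin m) ⊕ (↥(Xᶜ) × Bool)

variable {X : Set V} {m : ℕ}

def vtx (v0 : V) : Nd X m → V
  | Sum.inl (Sum.inl x) => x
  | Sum.inl (Sum.inr _) => v0
  | Sum.inr (v, _) => v

def sg : Nd X m → Bool
  | Sum.inl _ => true
  | Sum.inr (_, s) => s

def isD : Nd X m → Prop
  | Sum.inl (Sum.inr _) => True
  | _ => False

def swp : Nd X m → Nd X m
  | Sum.inl a => Sum.inl a
  | Sum.inr (v, s) => Sum.inr (v, !s)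

theorem swp_swp (a : Nd X m) : swp (swp a) = a := by
  rcases a with a | ⟨v, s⟩ <;> simp [swp]

def RR (B : BidirGraph V E) (v0 : V) (a b : Nd X m) : Prop :=
  ∃ (e : E) (d : Bool), B.tl e d = vtx v0 a ∧ B.hd e d = vtx v0 b ∧
    (vtx v0 a ∉ X → B.tlSgn e d = sg a) ∧ (vtx v0 b ∉ X → B.hdSgn e d = sg b)

theorem RR_symm (B : BidirGraph V E) (v0 : V) (a b : Nd X m) (h : RR B v0 a b) : RR B v0 b a := by
  obtain ⟨e, d, h1, h2, h3, h4⟩ := h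
  refine ⟨e, !d, ?_, ?_, ?_, ?_⟩ <;> cases d <;> simp_all [tl, hd, tlSgn, hdSgn]

def GG (B : BidirGraph V E) (X : Set V) (m : ℕ) (v0 : V) : SimpleGraph (Nd X m) :=
  SimpleGraph.fromRel (fun a b => isD a ∨ isD b ∨ vtx v0 a = vtx v0 b ∨ RR B v0 a b)

theorem GG_adj (B : BidirGraph V E) (v0 : V) (a b : Nd X m) :
    (GG B X m v0).Adj a b ↔ a ≠ b ∧ (isD a ∨ isD b ∨ vtx v0 a = vtx v0 b ∨ RR B v0 a b) := by
  rw [GG, SimpleGraph.fromRel_adj]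
  have := RR_symm B v0 a b
  have := RR_symm B v0 b a
  grind

theorem vtx_eq (v0 : V) (a b : Nd X m) (ha : ¬ isD a) (hb : ¬ isD b) (h : vtx v0 a = vtx v0 b) :
    a = b ∨ a = swp b := by
  rcases a with (a | a) | ⟨a, s⟩ <;> rcases b with (b | b) | ⟨b, t⟩ <;>
    simp [isD, vtx, swp] at *
  · exact Subtype.ext h
  · exact (b.2 (h ▸ a.2)).elim
  · exact (a.2 (h ▸ b.2)).elim
  · have := Subtype.ext h
    subst this
    cases s <;> cases t <;> simp

theorem moved (v0 : V) (a : Nd X m) (h : swp a ≠ a) :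
    ¬ isD a ∧ vtx v0 a ∉ X ∧ ¬ isD (swp a) ∧ sg (swp a) = !(sg a) := by
  rcases a with a | ⟨⟨a, ha⟩, s⟩ 
  · exact absurd rfl h
  · exact ⟨fun h => h, ha, fun h => h, rfl⟩

theorem vtx_swp (v0 : V) (a : Nd X m) : vtx v0 (swp a) = vtx v0 a := by
  rcases a with (a | a) | ⟨a, s⟩ <;> rfl

theorem isD_swp (a : Nd X m) : isD (swp a) ↔ isD a := by
  rcases a with (a | a) | ⟨a, s⟩ <;> rfl

theorem primal [Fintype V] (B : BidirGraph V E) (X : Set V) (m k : ℕ) (v0 : V)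
    (hm : X.ncard = m + 2 * k + 2)
    (h : ∃ M : (GG B X m v0).Subgraph, M.IsPerfectMatching) :
    ∃ (n : Fin (k + 1) → ℕ) (P : ∀ i, B.Walk (n i)),
        (∀ i, 0 < n i ∧ (P i).IsPath ∧
          (P i).vert 0 ∈ X ∧ (P i).vert (Fin.last (n i)) ∈ X) ∧
        (∀ i j, i ≠ j → Disjoint (P i).verts (P j).verts) := by
  classical
  obtain ⟨N, hN⟩ := h
  rw [SimpleGraph.Subgraph.isPerfectMatching_iff] at hN
  choose f hf1 hf2 using hN
  have hff : Function.Involutive f := fun a => (hf2 (f a) a (hf1 a).symm).symm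
  have hadj : ∀ a, (GG B X m v0).Adj a (f a) := fun a => (hf1 a).adj_sub
  set P : Equiv.Perm (Nd X m) := hff.toPerm with hPdef
  set M : Equiv.Perm (Nd X m) := Function.Involutive.toPerm swp swp_swp with hMdef
  have hM : ∀ a, M (M a) = a := swp_swp
  have hP : ∀ a, P (P a) = a := hff
  have hne : ∀ a, P a ≠ a := fun a h => (hadj a).ne h.symm
  let ι : X → Nd X m := fun x => Sum.inl (Sum.inl x)
  have hιM : ∀ x, M (ι x) = ι x := fun x => rfl
  -- the path from x
  have hpath : ∀ x y : X, ofin M P (ι x) = ι y →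
      ∃ W : B.Walk (olen M P (ι x)), W.IsPath ∧ W.vert 0 = x ∧ W.vert (Fin.last _) = y ∧
        (∀ j : Fin (olen M P (ι x) + 1), ¬ isD (((P * M) ^ (j : ℕ)) (ι x)) ∧ W.vert j = vtx v0 (((P * M) ^ (j : ℕ)) (ι x))) := by
    intro x y hxy
    obtain ⟨hpos, hfin⟩ := olen_spec M P (ι x) (hιM x)
    have hreal : ∀ j : ℕ, j ≤ olen M P (ι x) → ¬ isD (((P * M) ^ j) (ι x)) := by
      intro j hj
      rcases Nat.eq_zero_or_pos j with h0 | h0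
      · subst h0; simp [ι, isD]
      rcases hj.eq_or_lt with h1 | h1
      · have : ((P * M) ^ j) (ι x) = ι y := by rw [← hxy, h1]; rfl
        rw [this]; simp [ι, isD]
      · exact (moved v0 _ (olen_min M P (ι x) j h0 h1)).1
    have hinj : ∀ j l : ℕ, j < l → l ≤ olen M P (ι x) →
        vtx v0 (((P * M) ^ j) (ι x)) ≠ vtx v0 (((P * M) ^ l) (ι x)) := by
      intro j l hjl hl h
      have h1 := orb_L2 M P hM hP hne (ι x) (hιM x) j l hjl hl
      rcases vtx_eq v0 _ _ (hreal j (by omega)) (hreal l hl) h with h2 | h2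
      · exact h1.1 h2
      · exact h1.2 h2
    have hR : ∀ j : Fin (olen M P (ι x)),
        RR B v0 (swp (((P * M) ^ (j : ℕ)) (ι x))) (((P * M) ^ ((j : ℕ) + 1)) (ι x)) := by
      intro j
      have h1 := hadj (swp (((P * M) ^ (j : ℕ)) (ι x)))
      have h2 : f (swp (((P * M) ^ (j : ℕ)) (ι x))) = ((P * M) ^ ((j : ℕ) + 1)) (ι x) := by
        rw [pow_succ', Equiv.Perm.mul_apply]; rfl
      rw [h2, GG_adj, isD_swp, vtx_swp] at h1
      have h3 := hreal j (by omega)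
      have h4 := hreal (j + 1) (by omega)
      have h5 := hinj j (j + 1) (by omega) (by omega)
      tauto
    choose e d he1 he2 he3 he4 using hR
    refine ⟨⟨fun j => vtx v0 (((P * M) ^ (j : ℕ)) (ι x)), e, d, ?_, ?_, ?_⟩, ?_, ?_, ?_, ?_⟩
    · intro j; rw [he1, vtx_swp]; rfl
    · intro j; rw [he2]; rfl
    · intro i j hij
      have h1 : swp (((P * M) ^ (j : ℕ)) (ι x)) ≠ ((P * M) ^ (j : ℕ)) (ι x) :=
        olen_min M P (ι x) j (by omega) j.2
      obtain ⟨-, h2, -, h4⟩ := moved v0 _ h1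
      have h5 := he4 i
      rw [hij] at h5
      rw [h5 h2, he3 j (by rw [vtx_swp]; exact h2), h4]
      simp
    · intro i j hij
      by_contra hne'
      rcases lt_or_gt_of_ne (fun h => hne' (Fin.ext h) : (i : ℕ) ≠ j) with h | h
      · exact hinj i j h (by omega) hij
      · exact hinj j i h (by omega) hij.symm
    · simp [ι, vtx]
    · have : ((P * M) ^ (olen M P (ι x))) (ι x) = ι y := hxy
      simp [this]; rfl
    · intro j; exact ⟨hreal j (by omega), rfl⟩
  -- counting
  have hιinj : Function.Injective ι := fun a b h => by simpa [ι] using h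
  have hfix : ∀ a : Nd X m, M a = a → (∃ y, a = ι y) ∨ ∃ t : Fin m, a = Sum.inl (Sum.inr t) := by
    rintro ((a | a) | ⟨a, s⟩) h
    · left; exact ⟨a, rfl⟩
    · right; exact ⟨a, rfl⟩
    · have h' : swp (Sum.inr (a, s) : Nd X m) = Sum.inr (a, s) := h
      simp [swp] at h'
  have hend := fun x => hfix _ (olen_spec M P (ι x) (hιM x)).2
  have hinv : ∀ x, ofin M P (ofin M P (ι x)) = ι x := fun x => ofin_ofin M P hM hP hne _ (hιM x)
  let eV := Fintype.equivFin V
  let Y : Finset X := Finset.univ.filter (fun x => ∃ y, ofin M P (ι x) = ι y ∧ eV x < eV y)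
  let Z : Finset X := Finset.univ.filter (fun x => ∃ y, ofin M P (ι x) = ι y ∧ eV y < eV x)
  let Q : Finset X := Finset.univ.filter (fun x => ∃ t : Fin m, ofin M P (ι x) = Sum.inl (Sum.inr t))
  have hfinj : ∀ x x', ofin M P (ι x) = ofin M P (ι x') → x = x' := by
    intro x x' h
    apply hιinj; rw [← hinv x, h, hinv]
  have hcov : (Finset.univ : Finset X) ⊆ Y ∪ Z ∪ Q := by
    intro x _
    rcases hend x with ⟨y, hy⟩ | ⟨t, ht⟩
    · have hxy : (x : V) ≠ y := by
        intro h
        have := ofin_ne M P hM hP hne (ι x) (hιM x)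
        rw [hy, Subtype.ext h] at this
        exact this rfl
      rcases lt_or_gt_of_ne (fun h => hxy (eV.injective h)) with h | h
      · simp only [Finset.mem_union]; left; left; simp only [Y, Finset.mem_filter]
        exact ⟨Finset.mem_univ _, y, hy, h⟩
      · simp only [Finset.mem_union]; left; right; simp only [Z, Finset.mem_filter]
        exact ⟨Finset.mem_univ _, y, hy, h⟩
    · simp only [Finset.mem_union]; right; simp only [Q, Finset.mem_filter]
      exact ⟨Finset.mem_univ _, t, ht⟩
  have hZY : Z.card ≤ Y.card := by
    have hz : ∀ x ∈ Z, ∃ y, ofin M P (ι x) = ι y ∧ eV y < eV x := fun x hx => (Finset.mem_filter.1 hx).2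
    choose! g hg1 hg2 using hz
    refine Finset.card_le_card_of_injOn g ?_ ?_
    · intro x hx
      simp only [Y, Finset.coe_filter, Finset.mem_univ, true_and, Set.mem_setOf_eq]
      exact ⟨x, by rw [← hg1 x hx, hinv], hg2 x hx⟩
    · intro x hx x' hx' h
      exact hfinj x x' (by rw [hg1 x hx, hg1 x' hx', h])
  have hQm : Q.card ≤ m := by
    have hz : ∀ x ∈ Q, ∃ t : Fin m, ofin M P (ι x) = Sum.inl (Sum.inr t) :=
      fun x hx => (Finset.mem_filter.1 hx).2
    rcases Q.eq_empty_or_nonempty with h0 | ⟨q, hq⟩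
    · rw [h0]; simp
    have : Nonempty (Fin m) := ⟨(hz q hq).choose⟩
    choose! g hg1 using hz
    have := Finset.card_le_card_of_injOn (s := Q) (t := Finset.univ) g (by intro x _; simp) (by
      intro x hx x' hx' h
      exact hfinj x x' (by rw [hg1 x hx, hg1 x' hx', h]))
    simpa using this
  have hYk : k + 1 ≤ Y.card := by
    have h1 := Finset.card_le_card hcov
    have h2 := Finset.card_union_le (Y ∪ Z) Q
    have h3 := Finset.card_union_le Y Z
    have h4 : (Finset.univ : Finset X).card = X.ncard := by
      rw [Finset.card_univ, ← Nat.card_eq_fintype_card, Nat.card_coe_set_eq]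
    omega
  obtain ⟨emb⟩ := Function.Embedding.nonempty_of_card_le (α := Fin (k + 1)) (β := Y) (by simpa using hYk)
  have hsel : ∀ i, ∃ y, ofin M P (ι (emb i)) = ι y ∧ eV (emb i).1 < eV y :=
    fun i => (Finset.mem_filter.1 (emb i).2).2
  choose y hy1 hy2 using hsel
  choose W hW1 hW2 hW3 hW4 using fun i => hpath (emb i).1 (y i) (hy1 i)
  refine ⟨fun i => olen M P (ι (emb i)), W, ?_, ?_⟩
  · intro i
    refine ⟨(olen_spec M P _ (hιM _)).1, hW1 i, ?_, ?_⟩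
    · rw [hW2]; exact Subtype.coe_prop _
    · rw [hW3]; exact Subtype.coe_prop _
  · intro i j hij
    rw [Set.disjoint_left]
    rintro _ ⟨a, rfl⟩ ⟨b, hb⟩
    rw [(hW4 j b).2, (hW4 i a).2] at hb
    have h1 := vtx_eq v0 _ _ (hW4 i a).1 (hW4 j b).1 hb.symm
    rcases orb_disj M P hM hP _ _ (hιM _) (hιM _) _ _ h1 with h2 | h2
    · exact hij (emb.injective (Subtype.ext (hιinj h2)))
    · have h3 : y j = (emb i).1 := hιinj (by rw [← hy1, h2])
      have h4 : y i = (emb j).1 := hιinj (by rw [← hy1, h2, hinv])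
      have h5 := hy2 i
      have h6 := hy2 j
      rw [h4] at h5; rw [h3] at h6
      exact absurd h5 (not_lt.2 h6.le)

open Classical in
noncomputable def nd (X : Set V) (m : ℕ) (v : V) (s : Bool) : Nd X m :=
  if h : v ∈ X then Sum.inl (Sum.inl ⟨v, h⟩) else Sum.inr (⟨v, h⟩, s)

theorem vtx_nd (v0 v : V) (s : Bool) : vtx v0 (nd X m v s) = v := by
  unfold nd; split <;> rfl

theorem nd_X (v : V) (s t : Bool) (h : v ∈ X) : nd X m v s = nd X m v t := by
  simp [nd, h]

theorem sg_nd (v : V) (s : Bool) (h : v ∉ X) : sg (nd X m v s) = s := by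
  simp [nd, h, sg]

set_option maxHeartbeats 1000000 in
theorem dual [Fintype V] (B : BidirGraph V E) (X : Set V) (m k : ℕ) (v0 : V)
    (hm : X.ncard = m + 2 * k + 2)
    (U : Set (Nd X m)) (K : Set (Set (Nd X m))) (hcard : U.ncard + 2 ≤ K.ncard)
    (hK : ∀ C ∈ K, Odd C.ncard ∧ Disjoint C U ∧
      ∀ a ∈ C, ∀ b, b ∉ U → (GG B X m v0).Adj a b → b ∈ C)
    (hdis : ∀ C ∈ K, ∀ C' ∈ K, ∀ a, a ∈ C → a ∈ C' → C = C') :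
    ∃ S : Finset V, S.card ≤ 2 * k ∧ ¬ ∃ n : ℕ, 0 < n ∧ ∃ W : B.Walk n, W.IsPath ∧
          W.vert 0 ∈ X ∧ W.vert (Fin.last n) ∈ X ∧ W.Avoids ↑S := by
  classical
  have hclosed : ∀ C ∈ K, ∀ a ∈ C, ∀ b, b ∉ U → (GG B X m v0).Adj a b → b ∈ C :=
    fun C hC => (hK C hC).2.2
  have hnU : ∀ C ∈ K, ∀ a ∈ C, a ∉ U := fun C hC a ha => Set.disjoint_left.1 (hK C hC).2.1 ha
  have hD : ∀ a, isD a → a ∈ U := by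
    intro a ha
    by_contra haU
    have h1 : ∀ C ∈ K, a ∈ C := by
      intro C hC
      have h0 : C.ncard ≠ 0 := by
        intro h; have := (hK C hC).1; rw [h] at this; simp at this
      obtain ⟨b, hb⟩ := Set.nonempty_of_ncard_ne_zero h0
      by_cases hab : b = a
      · exact hab ▸ hb
      · exact hclosed C hC b hb a haU (by rw [GG_adj]; exact ⟨hab, Or.inr (Or.inl ha)⟩)
    have : K.ncard ≤ 1 := by
      rw [Set.ncard_le_one_iff]
      intro C C' hC hC'
      exact hdis C hC C' hC' a (h1 C hC) (h1 C' hC')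
    omega
  have hrep : ∀ C ∈ K, ∃ v, (v ∈ X ∧ nd X m v true ∈ C) ∨
      (v ∉ X ∧ ∃ s, nd X m v s ∈ C ∧ nd X m v (!s) ∈ U) := by
    intro C hC
    by_contra hcon
    push Not at hcon
    have hinr : ∀ a ∈ C, swp a ≠ a ∧ swp a ∈ C := by
      rintro ((a | a) | ⟨⟨v, hv⟩, s⟩) ha
      · exact absurd (by simpa [nd] using ha) ((hcon a).1 a.2)
      · exact absurd (hD (Sum.inl (Sum.inr a)) trivial) (hnU C hC _ ha)
      · have hs : swp (Sum.inr (⟨v, hv⟩, s) : Nd X m) ≠ Sum.inr (⟨v, hv⟩, s) := by simp [swp]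
        refine ⟨hs, ?_⟩
        have hv' : v ∉ X := hv
        have h2 := (hcon v).2 hv' s (by simpa [nd, hv'] using ha)
        refine hclosed C hC _ ha _ (by simpa [nd, hv', swp] using h2) ?_
        rw [GG_adj, vtx_swp]
        exact ⟨hs.symm, by simp⟩
    have hodd := (hK C hC).1
    have hsum := Finset.sum_involution (s := C.toFinset) (f := fun _ => (1 : ZMod 2))
      (fun a _ => swp a) (fun _ _ => by decide) (fun a ha _ => (hinr a (by simpa using ha)).1)
      (fun a ha => by simpa using (hinr a (by simpa using ha)).2) (fun a _ => swp_swp a)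
    rw [Finset.sum_const, nsmul_eq_mul, mul_one, ZMod.natCast_eq_zero_iff_even,
      ← Set.ncard_eq_toFinset_card'] at hsum
    exact (Nat.not_even_iff_odd.2 hodd) hsum
  have : Nonempty V := ⟨v0⟩
  choose! rep hrep using hrep
  let T : Set V := {v | v ∉ X ∧ ∃ s, nd X m v s ∈ U}
  have hrepinj : Set.InjOn rep K := by
    intro C hC C' hC' h
    have h1 := hrep C hC
    have h2 := hrep C' hC'
    rw [← h] at h2
    rcases h1 with ⟨h1, h3⟩ | ⟨h1, s, h3, h4⟩ <;> rcases h2 with ⟨h2, h5⟩ | ⟨h2, t, h5, h6⟩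
    · exact hdis C hC C' hC' _ h3 h5
    · exact absurd h1 h2
    · exact absurd h2 h1
    · have : s = t := by
        by_contra hst
        have : t = !s := by
          revert hst; clear * -; revert s t; decide
        subst this
        exact hnU C' hC' _ h5 h4
      subst this
      exact hdis C hC C' hC' _ h3 h5
  have hrepsub : rep '' K ⊆ X ∪ T := by
    rintro _ ⟨C, hC, rfl⟩
    rcases hrep C hC with ⟨h1, -⟩ | ⟨h1, s, -, h4⟩
    · exact Or.inl h1
    · exact Or.inr ⟨h1, _, h4⟩
  have hT : T.ncard + m ≤ U.ncard := by
    let D : Set (Nd X m) := Set.range (fun t : Fin m => (Sum.inl (Sum.inr t) : Nd X m))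
    have hDm : D.ncard = m := by
      simp only [D]
      rw [← Set.image_univ, Set.ncard_image_of_injective _ (fun a b h => by simpa using h)]
      simp
    have hDU : D ⊆ U := by rintro _ ⟨t, rfl⟩; exact hD _ trivial
    have h1 : T ⊆ vtx v0 '' (U \ D) := by
      rintro v ⟨hv, s, hs⟩
      refine ⟨_, ⟨hs, ?_⟩, vtx_nd v0 v s⟩
      rintro ⟨t, ht⟩
      simp [nd, hv] at ht
    have h2 := Set.ncard_le_ncard h1
    have h3 := Set.ncard_image_le (f := vtx v0) (s := U \ D) (Set.toFinite _)
    have h4 := Set.ncard_sdiff_add_ncard_of_subset hDU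
    omega
  have hS : ((X ∪ T) \ rep '' K).ncard ≤ 2 * k := by
    have h1 := Set.ncard_sdiff_add_ncard_of_subset hrepsub
    rw [Set.ncard_image_of_injOn hrepinj] at h1
    have h2 := Set.ncard_union_le X T
    omega
  refine ⟨((X ∪ T) \ rep '' K).toFinset, by rwa [← Set.ncard_eq_toFinset_card'], ?_⟩
  rintro ⟨n, hn, W, hW, h0, hlast, hav⟩
  have hav' : ∀ i, W.vert i ∈ X ∪ T → ∃ C ∈ K, rep C = W.vert i := by
    intro i hi
    have := hav i
    simp only [Set.coe_toFinset, Set.mem_diff, not_and, not_not] at this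
    exact this hi
  have hadj : ∀ i : Fin n, (GG B X m v0).Adj
      (nd X m (W.vert i.castSucc) (B.tlSgn (W.edge i) (W.dir i)))
      (nd X m (W.vert i.succ) (B.hdSgn (W.edge i) (W.dir i))) := by
    intro i
    rw [GG_adj]
    refine ⟨?_, Or.inr (Or.inr (Or.inr ⟨W.edge i, W.dir i, ?_, ?_, ?_, ?_⟩))⟩
    · intro h
      have := congrArg (vtx v0) h
      rw [vtx_nd, vtx_nd] at this
      have := congrArg Fin.val (hW this)
      simp at this
    · rw [vtx_nd, W.tail_eq]
    · rw [vtx_nd, W.head_eq]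
    · rw [vtx_nd]; intro h; rw [sg_nd _ _ h]
    · rw [vtx_nd]; intro h; rw [sg_nd _ _ h]
  have hmid : ∀ i : Fin n, ∀ C ∈ K,
      nd X m (W.vert i.castSucc) (B.tlSgn (W.edge i) (W.dir i)) ∈ C →
      (∃ l : Fin (n + 1), (l : ℕ) ≤ i ∧ rep C = W.vert l) →
      W.vert i.succ ∉ X ∧
      ∃ C' ∈ K, nd X m (W.vert i.succ) (!(B.hdSgn (W.edge i) (W.dir i))) ∈ C' ∧
        (∃ l : Fin (n + 1), (l : ℕ) ≤ i + 1 ∧ rep C' = W.vert l) := by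
    rintro i C hC hout ⟨l, hl, hlC⟩
    have hcl := fun h => hclosed C hC _ hout _ h (hadj i)
    have hne : ∀ C' ∈ K, rep C' = W.vert i.succ → C' ≠ C := by
      rintro C' hC' h rfl
      rw [hlC] at h
      have := congrArg Fin.val (hW h)
      simp at this
      omega
    have hX : W.vert i.succ ∉ X := by
      intro hX
      obtain ⟨C', hC', hr⟩ := hav' i.succ (Or.inl hX)
      rcases hrep C' hC' with ⟨h1, h2⟩ | ⟨h1, -⟩
      · rw [hr, nd_X _ true (B.hdSgn (W.edge i) (W.dir i)) hX] at h2
        exact hne C' hC' hr (hdis C' hC' C hC _ h2 (hcl (hnU C' hC' _ h2)))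
      · exact h1 (hr ▸ hX)
    refine ⟨hX, ?_⟩
    by_cases hvT : W.vert i.succ ∈ T
    · obtain ⟨C', hC', hr⟩ := hav' i.succ (Or.inr hvT)
      rcases hrep C' hC' with ⟨h1, h2⟩ | ⟨-, s, h1, h2⟩
      · exact absurd (hr ▸ h1) hX
      rw [hr] at h1 h2
      refine ⟨C', hC', ?_, i.succ, by simp, hr⟩
      by_cases hs : B.hdSgn (W.edge i) (W.dir i) = s
      · exfalso
        have h3 := hcl (by rw [hs]; exact hnU C' hC' _ h1)
        rw [hs] at h3
        exact hne C' hC' hr (hdis C' hC' C hC _ h1 h3)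
      · have : (!(B.hdSgn (W.edge i) (W.dir i))) = s := by
          revert hs; cases B.hdSgn (W.edge i) (W.dir i) <;> cases s <;> simp
        rw [this]; exact h1
    · have hU' : ∀ s, nd X m (W.vert i.succ) s ∉ U := fun s hs => hvT ⟨hX, s, hs⟩
      refine ⟨C, hC, ?_, l, by omega, hlC⟩
      refine hclosed C hC _ (hcl (hU' _)) _ (hU' _) ?_
      rw [GG_adj, vtx_nd, vtx_nd]
      refine ⟨?_, by simp⟩
      intro h
      have := congrArg sg h
      rw [sg_nd _ _ hX, sg_nd _ _ hX] at this
      simp at this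
  have hinv : ∀ i : ℕ, ∀ hi : i < n, ∃ C ∈ K,
      nd X m (W.vert (Fin.castSucc ⟨i, hi⟩)) (B.tlSgn (W.edge ⟨i, hi⟩) (W.dir ⟨i, hi⟩)) ∈ C ∧
      (∃ l : Fin (n + 1), (l : ℕ) ≤ i ∧ rep C = W.vert l) := by
    intro i
    induction i with
    | zero =>
      intro hi
      obtain ⟨C, hC, hr⟩ := hav' 0 (Or.inl h0)
      refine ⟨C, hC, ?_, 0, by simp, hr⟩
      rcases hrep C hC with ⟨h1, h2⟩ | ⟨h1, -⟩
      · have : (Fin.castSucc ⟨0, hi⟩ : Fin (n + 1)) = 0 := rfl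
        rw [this, ← hr, nd_X _ _ true h1]
        exact h2
      · exact absurd (hr ▸ h0) h1
    | succ i ih =>
      intro hi
      obtain ⟨C, hC, h1, h2⟩ := ih (by omega)
      obtain ⟨-, C', hC', h3, h4⟩ := hmid ⟨i, by omega⟩ C hC h1 h2
      refine ⟨C', hC', ?_, h4⟩
      have h5 := W.sign_alt ⟨i, by omega⟩ ⟨i + 1, hi⟩ rfl
      have h6 : B.tlSgn (W.edge ⟨i + 1, hi⟩) (W.dir ⟨i + 1, hi⟩) =
          !(B.hdSgn (W.edge ⟨i, by omega⟩) (W.dir ⟨i, by omega⟩)) := by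
        revert h5
        generalize B.tlSgn (W.edge ⟨i + 1, hi⟩) (W.dir ⟨i + 1, hi⟩) = p
        generalize B.hdSgn (W.edge ⟨i, _⟩) (W.dir ⟨i, _⟩) = q
        cases p <;> cases q <;> simp
      rw [h6]
      exact h3
  obtain ⟨C, hC, h1, h2⟩ := hinv (n - 1) (by omega)
  have h3 := (hmid ⟨n - 1, by omega⟩ C hC h1 h2).1
  apply h3
  have : (Fin.succ ⟨n - 1, by omega⟩ : Fin (n + 1)) = Fin.last n := by
    ext; simp; omega
  rw [this]; exact hlast

end nodes
end BXP

/-- Twice the maximum number of pairwise vertex-disjoint `X`-paths (nontrivial paths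
with both endvertices in `X`) is at least the minimum size of a vertex set `S` such
that `B - S` contains no `X`-path. -/
theorem bidirected_X_paths {V E : Type} [Fintype V] [DecidableEq V] [Fintype E]
    (B : BidirGraph V E) (X : Set V) :
    2 * sSup {k : ℕ | ∃ (n : Fin k → ℕ) (P : ∀ i, B.Walk (n i)),
        (∀ i, 0 < n i ∧ (P i).IsPath ∧
          (P i).vert 0 ∈ X ∧ (P i).vert (Fin.last (n i)) ∈ X) ∧
        (∀ i j, i ≠ j → Disjoint (P i).verts (P j).verts)} ≥
      sInf {k : ℕ | ∃ S : Finset V, S.card = k ∧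
        ¬ ∃ n : ℕ, 0 < n ∧ ∃ W : B.Walk n, W.IsPath ∧
          W.vert 0 ∈ X ∧ W.vert (Fin.last n) ∈ X ∧ W.Avoids ↑S} := by
  classical
  set A := {k : ℕ | ∃ (n : Fin k → ℕ) (P : ∀ i, B.Walk (n i)),
        (∀ i, 0 < n i ∧ (P i).IsPath ∧
          (P i).vert 0 ∈ X ∧ (P i).vert (Fin.last (n i)) ∈ X) ∧
        (∀ i j, i ≠ j → Disjoint (P i).verts (P j).verts)} with hA
  have hbdd : BddAbove A := by
    refine ⟨Fintype.card V, ?_⟩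
    rintro k ⟨n, P, -, h2⟩
    have := Fintype.card_le_of_injective (fun i : Fin k => (P i).vert 0) (by
      intro i j hij
      by_contra hne
      exact Set.disjoint_left.1 (h2 i j hne) ⟨0, rfl⟩ ⟨0, hij.symm⟩)
    simpa using this
  obtain ⟨k, hk⟩ : ∃ k, k = sSup A := ⟨_, rfl⟩
  rw [← hk]
  have hk1 : k + 1 ∉ A := by
    intro h
    have := le_csSup hbdd h
    omega
  suffices h : ∃ S : Finset V, S.card ≤ 2 * k ∧ ¬ ∃ n : ℕ, 0 < n ∧ ∃ W : B.Walk n, W.IsPath ∧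
          W.vert 0 ∈ X ∧ W.vert (Fin.last n) ∈ X ∧ W.Avoids ↑S by
    obtain ⟨S, hS, h⟩ := h
    rw [ge_iff_le]
    refine le_trans (Nat.sInf_le ?_) hS
    exact ⟨S, rfl, h⟩
  rcases Nat.lt_or_ge X.ncard (2 * k + 2) with hX | hX
  · rcases X.eq_empty_or_nonempty with h0 | ⟨x, hx⟩
    · subst h0
      refine ⟨∅, by simp, ?_⟩
      rintro ⟨n, hn, W, hW, h0, -⟩
      exact h0
    · refine ⟨(X \ {x}).toFinset, ?_, ?_⟩
      · rw [← Set.ncard_eq_toFinset_card']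
        have := Set.ncard_sdiff_singleton_add_one hx
        omega
      · rintro ⟨n, hn, W, hW, h0, h1, hav⟩
        have h2 : W.vert 0 = x := by
          have := hav 0
          simp only [Set.coe_toFinset, Set.mem_diff, Set.mem_singleton_iff, not_and, not_not] at this
          exact this h0
        have h3 : W.vert (Fin.last n) = x := by
          have := hav (Fin.last n)
          simp only [Set.coe_toFinset, Set.mem_diff, Set.mem_singleton_iff, not_and, not_not] at this
          exact this h1
        have := congrArg Fin.val (hW (h2.trans h3.symm))
        simp at this
        omega
  · obtain ⟨m, hm⟩ := Nat.exists_eq_add_of_le' hX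
    have hne : X.Nonempty := Set.nonempty_of_ncard_ne_zero (by omega)
    obtain ⟨v0, -⟩ := hne
    have hev : Even (Fintype.card (BXP.Nd X m)) := by
      have h4 : Fintype.card X = X.ncard := by
        rw [← Nat.card_eq_fintype_card, Nat.card_coe_set_eq]
      rw [Fintype.card_sum, Fintype.card_sum, Fintype.card_prod, h4, Fintype.card_fin,
        Fintype.card_bool, hm]
      exact ⟨m + k + 1 + Fintype.card ↥(Xᶜ), by ring⟩
    by_cases hpm : ∃ M : (BXP.GG B X m v0).Subgraph, M.IsPerfectMatching
    · exact absurd (BXP.primal B X m k v0 (by omega) hpm) hk1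
    · obtain ⟨U, K, h1, h2, h3⟩ := BXP.tutte_aux _ hev hpm
      exact BXP.dual B X m k v0 (by omega) U K h1 h2 h3
end

section
/- Let A = (a_{ij}) be an m × n matrix with integer entries such that for each column j one has Σ_{i=1}^{m} |a_{ij}| ≤ 2. Then A is 2-regular, i.e., for every square non-singular submatrix R of A, the matrix 2·R⁻¹ has integer entries. -/
/-- A rational matrix `A` is `k`-regular if for every square non-singular submatrix
`R` of `A` (selected by injective row and column selections), the matrix `k • R⁻¹`
has integer entries. -/
def IsKRegular {R C : Type*} (k : ℕ) (A : Matrix R C ℚ) : Prop :=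
  ∀ (s : ℕ) (r : Fin s → R) (c : Fin s → C),
    Function.Injective r → Function.Injective c →
    (A.submatrix r c).det ≠ 0 →
    ∀ i j, ∃ z : ℤ, (k : ℚ) * (A.submatrix r c)⁻¹ i j = (z : ℚ)

def phiAux (x : ℚ) : ℚ := Int.fract x - Int.fract (-x)

lemma phiAux_neg (x : ℚ) : phiAux (-x) = -phiAux x := by
  unfold phiAux; rw [neg_neg]; ring

lemma phiAux_sub {x y : ℚ} {z : ℤ} (h : x - y = z) : phiAux x = phiAux y := by
  have h1 : x = y + z := by linarith
  have h2 : -x = -y + ((-z : ℤ) : ℚ) := by push_cast; linarith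
  unfold phiAux
  rw [h2, h1, Int.fract_add_intCast, Int.fract_add_intCast]

lemma phiAux_add {x y : ℚ} {z : ℤ} (h : x + y = z) : phiAux x + phiAux y = 0 := by
  have := phiAux_sub (x := x) (y := -y) (z := z) (by linarith)
  rw [phiAux_neg] at this; linarith

lemma phiAux_two {x : ℚ} {z : ℤ} (h : 2 * x = z) : phiAux x = 0 := by
  have := phiAux_add (x := x) (y := x) (z := z) (by linarith)
  linarith

lemma phiAux_zero {x : ℚ} (h : phiAux x = 0) : ∃ z : ℤ, 2 * x = z := by
  unfold phiAux at h
  refine ⟨⌊x⌋ - ⌊-x⌋, ?_⟩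
  have h1 := Int.fract_add_floor x
  have h2 := Int.fract_add_floor (-x)
  push_cast; linarith

lemma col_aux {s : ℕ} (b : Fin s → ℤ) (hb : ∑ k, |b k| ≤ 2) (y : Fin s → ℚ) (z : ℤ)
    (h : ∑ k, y k * (b k : ℚ) = z) : ∑ k, phiAux (y k) * (b k : ℚ) = 0 := by
  have hsub : ∀ t : Finset (Fin s), ∑ k ∈ t, |b k| ≤ 2 := fun t =>
    (Finset.sum_le_sum_of_subset_of_nonneg (Finset.subset_univ t)
      (fun _ _ _ => abs_nonneg _)).trans hb
  by_cases h0 : ∃ a, b a ≠ 0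
  swap
  · push Not at h0
    simp [h0]
  obtain ⟨a, ha⟩ := h0
  by_cases h1 : ∃ c, c ≠ a ∧ b c ≠ 0
  · obtain ⟨c, hca, hc⟩ := h1
    have hz : ∀ k, k ≠ a ∧ k ≠ c → b k = 0 := by
      rintro k ⟨hka, hkc⟩
      have := hsub {k, a, c}
      rw [Finset.sum_insert (by simp [hka, hkc]), Finset.sum_pair hca.symm] at this
      have e1 := abs_pos.2 ha
      have e2 := abs_pos.2 hc
      by_contra hk
      have e3 := abs_pos.2 hk
      omega
    have hac := hsub {a, c}
    rw [Finset.sum_pair hca.symm] at hac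
    rw [Fintype.sum_eq_add a c hca.symm (fun k hk => by simp [hz k hk])] at h ⊢
    have e1 := abs_pos.2 ha
    have e2 := abs_pos.2 hc
    have ea : |b a| = 1 := by omega
    have ec : |b c| = 1 := by omega
    rcases (abs_eq zero_le_one).1 ea with ea | ea <;>
    rcases (abs_eq zero_le_one).1 ec with ec | ec <;> rw [ea, ec] at h ⊢ <;> push_cast at h ⊢
    · have := phiAux_add (x := y a) (y := y c) (z := z) (by linarith)
      linarith
    · have := phiAux_sub (x := y a) (y := y c) (z := z) (by linarith)
      linarith
    · have := phiAux_sub (x := y c) (y := y a) (z := z) (by linarith)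
      linarith
    · have := phiAux_add (x := y a) (y := y c) (z := -z) (by push_cast; linarith)
      linarith
  · push Not at h1
    rw [Fintype.sum_eq_single a (fun k hk => by simp [h1 k hk])] at h ⊢
    have hac := hsub {a}
    rw [Finset.sum_singleton] at hac
    obtain ⟨l, u⟩ := abs_le.1 hac
    have : ∃ w : ℤ, 2 * y a = w := by
      have : b a = -2 ∨ b a = -1 ∨ b a = 1 ∨ b a = 2 := by omega
      rcases this with e | e | e | e <;> rw [e] at h <;> push_cast at h
      · exact ⟨-z, by push_cast; linarith⟩
      · exact ⟨-2 * z, by push_cast; linarith⟩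
      · exact ⟨2 * z, by push_cast; linarith⟩
      · exact ⟨z, by linarith⟩
    obtain ⟨w, hw⟩ := this
    rw [phiAux_two hw, zero_mul]

/-- An integer matrix whose columns each have entries summing in absolute value to
at most `2` is `2`-regular. -/
theorem int_matrix_col_sum_le_two_is_two_regular {m n : ℕ}
    (A : Matrix (Fin m) (Fin n) ℤ)
    (h : ∀ j, ∑ i, |A i j| ≤ 2) :
    IsKRegular 2 (A.map fun z => (z : ℚ)) := by
  intro s r c hr _ hdet i j
  set B := (A.map fun z => (z : ℚ)).submatrix r c with hB
  have hcol : ∀ l, ∑ k, |A (r k) (c l)| ≤ 2 := by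
    intro l
    refine le_trans ?_ (h (c l))
    rw [← Finset.sum_image (s := Finset.univ) (g := r) (f := fun i => |A i (c l)|)
      (fun _ _ _ _ e => hr e)]
    exact Finset.sum_le_sum_of_subset_of_nonneg (Finset.subset_univ _)
      (fun _ _ _ => abs_nonneg _)
  have hinv : B⁻¹ * B = 1 := Matrix.nonsing_inv_mul B (isUnit_iff_ne_zero.2 hdet)
  have hz : Matrix.vecMul (fun k => phiAux (B⁻¹ i k)) B = 0 := by
    funext l
    have e := congrFun (congrFun hinv i) l
    rw [Matrix.mul_apply] at e
    refine col_aux (fun k => A (r k) (c l)) (hcol l) (fun k => B⁻¹ i k)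
      (if i = l then 1 else 0) ?_
    refine Eq.trans e ?_
    rw [Matrix.one_apply]; split_ifs <;> simp
  have := Matrix.eq_zero_of_vecMul_eq_zero hdet hz
  exact_mod_cast phiAux_zero (congrFun this j)
end

section
/- A rational m × n matrix A is 1-regular if and only if for every integer vector b of length m, the polyhedron {x ∈ ℝⁿ : Ax ≤ b, x ≥ 0} is integral. -/
open Matrix

/-- A polyhedron `P ⊆ ℝⁿ` is integral if for every objective `c` for which the
supremum of `c ⬝ᵥ x` over `P` is finite (`P` nonempty and the objective bounded
above), the maximum is attained by an integral vector. -/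
def IsIntegralPolyhedron {n : ℕ} (P : Set (Fin n → ℝ)) : Prop :=
  ∀ c : Fin n → ℝ, P.Nonempty → BddAbove ((fun x => c ⬝ᵥ x) '' P) →
    ∃ x ∈ P, (∀ i, ∃ z : ℤ, x i = (z : ℝ)) ∧ ∀ y ∈ P, c ⬝ᵥ y ≤ c ⬝ᵥ x

lemma ratio_step {ι : Type*} [Fintype ι] (g l : ι → ℝ) (hg : ∀ k, 0 ≤ g k)
    (hz : ∀ k, g k = 0 → l k = 0) (hl : ∃ k, l k < 0) :
    ∃ t : ℝ, 0 ≤ t ∧ (∀ k, 0 ≤ g k + t * l k) ∧ ∃ k, g k ≠ 0 ∧ g k + t * l k = 0 := by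
  classical
  obtain ⟨k0, hk0⟩ := hl
  obtain ⟨k, hk, hmin⟩ := Finset.exists_min_image (Finset.univ.filter fun k => l k < 0)
    (fun k => g k / (- l k)) ⟨k0, by simpa using hk0⟩
  simp only [Finset.mem_filter, Finset.mem_univ, true_and] at hk hmin
  have ht : 0 ≤ g k / (- l k) := div_nonneg (hg k) (by linarith)
  refine ⟨g k / (- l k), ht, fun j => ?_, k, fun h => by have := hz k h; linarith, ?_⟩
  · by_cases hj : l j < 0
    · have h1 := hmin j hj
      rw [le_div_iff₀ (by linarith)] at h1
      linarith
    · have := mul_nonneg ht (not_lt.1 hj)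
      linarith [hg j]
  · have : l k ≠ 0 := hk.ne
    field_simp
    ring

def IsVtx {ι E : Type*} [AddCommGroup E] [Module ℝ E] (L : ι → E →ₗ[ℝ] ℝ) (a : ι → ℝ) (x : E) :
    Prop := ∀ d, (∀ k, a k + L k x = 0 → L k d = 0) → d = 0

lemma to_vtx {ι E : Type*} [Fintype ι] [AddCommGroup E] [Module ℝ E] (L : ι → E →ₗ[ℝ] ℝ)
    (a : ι → ℝ) (hL : ∀ d, (∀ k, L k d = 0) → d = 0) (c : E →ₗ[ℝ] ℝ) (M : ℝ)
    (hM : ∀ x, (∀ k, 0 ≤ a k + L k x) → c x ≤ M) (N : ℕ) :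
    ∀ x, (∀ k, 0 ≤ a k + L k x) → Set.ncard {k | a k + L k x ≠ 0} = N →
      ∃ y, (∀ k, 0 ≤ a k + L k y) ∧ c x ≤ c y ∧ IsVtx L a y := by
  induction N using Nat.strong_induction_on with
  | _ N ih =>
  intro x hx hN
  by_cases hv : IsVtx L a x
  · exact ⟨x, hx, le_rfl, hv⟩
  unfold IsVtx at hv
  push Not at hv
  obtain ⟨d, hd, hd0⟩ := hv
  have key : ∃ e : E, (∀ k, a k + L k x = 0 → L k e = 0) ∧ 0 ≤ c e ∧ ∃ k, L k e < 0 := by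
    have pos : ∀ e : E, 0 < c e → ∃ k, L k e < 0 := by
      intro e he
      by_contra! hcon
      have h1 := hM (x + ((M - c x + 1) / c e) • e) (fun k => by
        have h2 : 0 ≤ (M - c x + 1) / c e := div_nonneg (by linarith [hM x hx]) he.le
        have := mul_nonneg h2 (hcon k)
        simp only [map_add, map_smul, smul_eq_mul]
        linarith [hx k])
      simp only [map_add, map_smul, smul_eq_mul] at h1
      rw [div_mul_cancel₀ _ he.ne'] at h1
      linarith
    have hdn : ∀ k, a k + L k x = 0 → L k (-d) = 0 := fun k hk => by simp [hd k hk]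
    rcases lt_trichotomy (c d) 0 with h | h | h
    · have : 0 < c (-d) := by simpa using h
      exact ⟨-d, hdn, this.le, pos _ this⟩
    · have : ∃ k, L k d ≠ 0 := by
        by_contra! hcon
        exact hd0 (hL d hcon)
      obtain ⟨k, hk⟩ := this
      rcases lt_or_gt_of_ne hk with h' | h'
      · exact ⟨d, hd, h.ge, k, h'⟩
      · exact ⟨-d, hdn, by simp [h], k, by simpa using h'⟩
    · exact ⟨d, hd, h.le, pos _ h⟩
  obtain ⟨e, he, hce, hneg⟩ := key
  obtain ⟨t, ht, hge, k, hk, hk'⟩ := ratio_step (fun k => a k + L k x) (fun k => L k e) hx he hneg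
  have heq : ∀ k, a k + L k (x + t • e) = a k + L k x + t * L k e := fun k => by
    simp only [map_add, map_smul, smul_eq_mul]; ring
  obtain ⟨y, hy, hcy, hvy⟩ := ih _ (by
    rw [← hN]
    refine Set.ncard_lt_ncard (t := {k | a k + L k x ≠ 0}) ?_ (Set.toFinite _)
    refine ⟨fun j hj => ?_, fun hsub => ?_⟩
    · intro h0
      apply hj
      rw [heq, h0, he j h0]; simp
    · exact hsub hk (by rw [heq]; exact hk')) (x + t • e) (fun k => by rw [heq]; exact hge k) rfl
  refine ⟨y, hy, le_trans ?_ hcy, hvy⟩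
  simp only [map_add, map_smul, smul_eq_mul]
  have := mul_nonneg ht hce
  linarith

lemma lp_vtx {ι E : Type*} [Fintype ι] [AddCommGroup E] [Module ℝ E] (L : ι → E →ₗ[ℝ] ℝ)
    (a : ι → ℝ) (hL : ∀ d, (∀ k, L k d = 0) → d = 0) (c : E →ₗ[ℝ] ℝ) (M : ℝ)
    (hM : ∀ x, (∀ k, 0 ≤ a k + L k x) → c x ≤ M) (x : E) (hx : ∀ k, 0 ≤ a k + L k x) :
    ∃ y, (∀ k, 0 ≤ a k + L k y) ∧ IsVtx L a y ∧ ∀ z, (∀ k, 0 ≤ a k + L k z) → c z ≤ c y := by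
  have hfin : Set.Finite {y | (∀ k, 0 ≤ a k + L k y) ∧ IsVtx L a y} := by
    refine Set.Finite.of_injOn (f := fun y => {k | a k + L k y = 0})
      (t := (Set.univ : Set (Set ι))) (fun _ _ => trivial) ?_ (Set.toFinite _)
    intro y hy z hz hyz
    have := hy.2 (y - z) (fun k hk => by
      have hk2 : k ∈ {k | a k + L k z = 0} := by
        have : k ∈ {k | a k + L k y = 0} := hk
        simp only at hyz
        rwa [hyz] at this
      have hk3 : a k + L k z = 0 := hk2
      rw [map_sub]; linarith)
    exact sub_eq_zero.1 this
  obtain ⟨y0, h1, _, h3⟩ := to_vtx L a hL c M hM _ x hx rfl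
  obtain ⟨y, hy, hmax⟩ := Set.exists_max_image _ c hfin ⟨y0, h1, h3⟩
  refine ⟨y, hy.1, hy.2, fun z hz => ?_⟩
  obtain ⟨w, h1, h2, h3⟩ := to_vtx L a hL c M hM _ z hz rfl
  exact h2.trans (hmax w ⟨h1, h3⟩)

/-- Extract an invertible square submatrix from an injective matrix. -/
lemma exists_rows {T : Type*} [Fintype T] {s : ℕ} (B : Matrix T (Fin s) ℝ)
    (h : ∀ d, B *ᵥ d = 0 → d = 0) :
    ∃ r : Fin s → T, Function.Injective r ∧ (B.submatrix r id).det ≠ 0 := by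
  obtain ⟨κ, f, hf, hspan, hli⟩ := exists_linearIndependent' ℝ B.row
  have hrank : B.rank = s := by
    have : LinearMap.ker B.mulVecLin = ⊥ := by
      rw [LinearMap.ker_eq_bot']
      intro d hd
      exact h d (by simpa using hd)
    rw [Matrix.rank, LinearMap.finrank_range_of_inj (LinearMap.ker_eq_bot.1 this)]
    simp
  have : Finite κ := Finite.of_injective f hf
  have := Fintype.ofFinite κ
  have hcard : Fintype.card κ = s := by
    rw [← hrank, Matrix.rank_eq_finrank_span_row, ← hspan, finrank_span_eq_card hli]
  let e : Fin s ≃ κ := (Fintype.equivFinOfCardEq hcard).symm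
  refine ⟨f ∘ e, hf.comp e.injective, ?_⟩
  have h2 : LinearIndependent ℝ (B.submatrix (f ∘ e) id).row := hli.comp e e.injective
  rw [Matrix.linearIndependent_rows_iff_isUnit, Matrix.isUnit_iff_isUnit_det] at h2
  exact h2.ne_zero

lemma vtx_integral {m n : ℕ} (A : Matrix (Fin m) (Fin n) ℚ) (hA : IsKRegular 1 A)
    (b : Fin m → ℤ) (x : Fin n → ℝ)
    (hv : ∀ d : Fin n → ℝ, (∀ j, x j = 0 → d j = 0) →
      (∀ i, ((A.map fun q => (q : ℝ)) *ᵥ x) i = b i → ((A.map fun q => (q : ℝ)) *ᵥ d) i = 0) →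
      d = 0) : ∀ j, ∃ z : ℤ, x j = z := by
  classical
  set B : Matrix (Fin m) (Fin n) ℝ := A.map fun q => (q : ℝ) with hB
  let e := (Fintype.equivFin {j // x j ≠ 0}).symm
  let s := Fintype.card {j // x j ≠ 0}
  let c : Fin s → Fin n := fun k => (e k).1
  have hc : Function.Injective c := Subtype.val_injective.comp e.injective
  have hcx : ∀ j, x j ≠ 0 → ∃ k, c k = j := fun j hj => ⟨e.symm ⟨j, hj⟩, by simp [c]⟩
  have hsum : ∀ (d : Fin n → ℝ), (∀ j, x j = 0 → d j = 0) → ∀ i,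
      (B *ᵥ d) i = ∑ k, B i (c k) * d (c k) := by
    intro d hd i
    simp only [Matrix.mulVec, dotProduct]
    symm
    refine Finset.sum_of_injOn c hc.injOn (by simp) ?_ (by simp)
    intro j _ hj
    rw [hd j, mul_zero]
    by_contra h
    obtain ⟨k, hk⟩ := hcx j h
    exact hj ⟨k, by simp, hk⟩
  let T := {i // (B *ᵥ x) i = b i}
  obtain ⟨r, hr, hdet⟩ := exists_rows (B.submatrix (Subtype.val : T → Fin m) c) (by
    intro d hd
    let d' : Fin n → ℝ := fun j => if h : x j ≠ 0 then d (e.symm ⟨j, h⟩) else 0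
    have hd'c : ∀ k, d' (c k) = d k := by
      intro k
      have : x (c k) ≠ 0 := (e k).2
      simp only [d', dif_pos this]
      congr 1
      exact e.symm_apply_apply k
    have hd'0 : ∀ j, x j = 0 → d' j = 0 := fun j hj => by simp [d', hj]
    have h0 := hv d' hd'0 (fun i hi => by
      rw [hsum d' hd'0]
      simp only [hd'c]
      exact congrFun hd ⟨i, hi⟩)
    funext k
    rw [← hd'c, h0]; rfl)
  let R : Matrix (Fin s) (Fin s) ℚ := A.submatrix (Subtype.val ∘ r) c
  have hRB : (B.submatrix (Subtype.val : T → Fin m) c).submatrix r id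
      = (Rat.castHom ℝ).mapMatrix R := rfl
  have hRdet : R.det ≠ 0 := by
    intro h
    apply hdet
    rw [hRB, ← RingHom.map_det, h, map_zero]
  have hint := hA s (Subtype.val ∘ r) c (Subtype.val_injective.comp hr) hc hRdet
  choose Z hZ using hint
  have hinv : (Rat.castHom ℝ).mapMatrix R⁻¹ * (Rat.castHom ℝ).mapMatrix R = 1 := by
    rw [← map_mul, Matrix.nonsing_inv_mul _ (isUnit_iff_ne_zero.2 hRdet), map_one]
  have hRx : (Rat.castHom ℝ).mapMatrix R *ᵥ (x ∘ c) = fun k => (b (r k).1 : ℝ) := by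
    funext k
    rw [← (r k).2, hsum x (fun _ h => h)]
    rfl
  intro j
  by_cases hj : x j = 0
  · exact ⟨0, by simpa using hj⟩
  obtain ⟨k, rfl⟩ := hcx j hj
  have h1 : x ∘ c = (Rat.castHom ℝ).mapMatrix R⁻¹ *ᵥ fun k => (b (r k).1 : ℝ) := by
    rw [← hRx, Matrix.mulVec_mulVec, hinv, Matrix.one_mulVec]
  refine ⟨∑ l, Z k l * b (r l).1, ?_⟩
  have h2 := congrFun h1 k
  simp only [Function.comp_apply] at h2
  rw [h2]
  simp only [Matrix.mulVec, dotProduct]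
  push_cast
  refine Finset.sum_congr rfl fun l _ => ?_
  have h3 : R⁻¹ k l = (Z k l : ℚ) := by
    have := hZ k l
    simpa using this
  simp [h3]

lemma forward {m n : ℕ} (A : Matrix (Fin m) (Fin n) ℚ) (hA : IsKRegular 1 A) (b : Fin m → ℤ) :
    IsIntegralPolyhedron
          {x : Fin n → ℝ |
            (A.map fun q => (q : ℝ)).mulVec x ≤ (fun i => (b i : ℝ)) ∧ 0 ≤ x} := by
  rintro c ⟨x, hx⟩ ⟨M, hM⟩
  set B : Matrix (Fin m) (Fin n) ℝ := A.map fun q => (q : ℝ) with hB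
  let L : Fin m ⊕ Fin n → (Fin n → ℝ) →ₗ[ℝ] ℝ :=
    Sum.elim (fun i => -(LinearMap.proj i ∘ₗ B.mulVecLin)) (fun j => LinearMap.proj j)
  let a : Fin m ⊕ Fin n → ℝ := Sum.elim (fun i => (b i : ℝ)) (fun _ => 0)
  have hP : ∀ y, (∀ k, 0 ≤ a k + L k y) ↔ (B *ᵥ y ≤ (fun i => (b i : ℝ)) ∧ 0 ≤ y) := by
    intro y
    rw [Sum.forall]
    simp [a, L, Pi.le_def]
  let cl : (Fin n → ℝ) →ₗ[ℝ] ℝ := dotProductBilin ℝ ℝ c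
  have hcl : ∀ y, cl y = c ⬝ᵥ y := fun y => rfl
  obtain ⟨y, hy, hv, hmax⟩ := lp_vtx L a (fun d hd => funext fun j => hd (Sum.inr j)) cl M
    (fun y hy => hM ⟨y, (hP y).1 hy, rfl⟩) x ((hP x).2 hx)
  refine ⟨y, (hP y).1 hy, vtx_integral A hA b y ?_, fun z hz => hmax z ((hP z).2 hz)⟩
  intro d h1 h2
  apply hv
  rw [Sum.forall]
  refine ⟨fun i hi => ?_, fun j hj => ?_⟩
  · have : (B *ᵥ y) i = b i := by
      simp [a, L] at hi
      linarith
    simpa [L] using h2 i this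
  · exact h1 j (by simpa [a, L] using hj)

lemma backward {m n : ℕ} (A : Matrix (Fin m) (Fin n) ℚ)
    (h : ∀ b : Fin m → ℤ, IsIntegralPolyhedron
          {x : Fin n → ℝ |
            (A.map fun q => (q : ℝ)).mulVec x ≤ (fun i => (b i : ℝ)) ∧ 0 ≤ x}) :
    IsKRegular 1 A := by
  classical
  intro s r c hr hc hdet i0 j0
  set R := A.submatrix r c with hR
  set B : Matrix (Fin m) (Fin n) ℝ := A.map fun q => (q : ℝ) with hB
  -- common denominator
  let D : ℤ := ∏ i, ∏ k, ((R i k).den : ℤ)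
  have hD : ∀ i k, ∃ z : ℤ, R i k * D = z := by
    intro i k
    have h1 : ((R i k).den : ℤ) ∣ D :=
      (Finset.dvd_prod_of_mem (fun k => ((R i k).den : ℤ)) (Finset.mem_univ k)).trans
      (Finset.dvd_prod_of_mem (fun i => ∏ k, ((R i k).den : ℤ)) (Finset.mem_univ i))
    obtain ⟨w, hw⟩ := h1
    refine ⟨(R i k).num * w, ?_⟩
    rw [hw]
    push_cast
    rw [← mul_assoc, Rat.mul_den_eq_num]
  have hDpos : 1 ≤ D := by
    have : 0 < D := Finset.prod_pos fun i _ => Finset.prod_pos fun k _ => by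
      exact_mod_cast (R i k).den_pos
    omega
  choose W hW using hD
  obtain ⟨N, hN0, hN⟩ : ∃ N : ℕ, 0 ≤ N ∧ ∀ k, |R⁻¹ k j0| ≤ N := by
    obtain ⟨N, hN⟩ := exists_nat_ge (∑ k, |R⁻¹ k j0|)
    exact ⟨N, N.zero_le, fun k => (Finset.single_le_sum (f := fun k => |R⁻¹ k j0|)
      (fun _ _ => abs_nonneg _) (Finset.mem_univ k)).trans hN⟩
  let z : Fin s → ℚ := fun k => R⁻¹ k j0 + D * N
  have hz : ∀ k, 0 ≤ z k := by
    intro k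
    have h1 : (1 : ℚ) ≤ D := by exact_mod_cast hDpos
    have h2 : (N : ℚ) ≤ D * N := le_mul_of_one_le_left (by positivity) h1
    have := neg_le_of_abs_le (hN k)
    simp only [z]; linarith
  -- the tight right-hand side
  let br : Fin s → ℤ := fun i => (if i = j0 then 1 else 0) + ∑ k, W i k * N
  have hRz : ∀ i, ∑ k, R i k * z k = br i := by
    intro i
    have h1 : ∑ k, R i k * R⁻¹ k j0 = if i = j0 then 1 else 0 := by
      have := congrFun (congrFun (Matrix.mul_nonsing_inv R (isUnit_iff_ne_zero.2 hdet)) i) j0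
      rw [Matrix.mul_apply, Matrix.one_apply] at this
      exact this
    simp only [z, mul_add, Finset.sum_add_distrib, h1, br]
    push_cast
    congr 1
    refine Finset.sum_congr rfl fun k _ => ?_
    rw [← hW, mul_assoc]
  -- the point
  let x : Fin n → ℝ := fun j => ∑ k, if c k = j then (z k : ℝ) else 0
  have hxc : ∀ k, x (c k) = z k := by
    intro k
    simp [x, hc.eq_iff]
  have hx0 : ∀ j, j ∉ Set.range c → x j = 0 := by
    intro j hj
    refine Finset.sum_eq_zero fun k _ => if_neg fun h => hj ⟨k, h⟩
  have hxnn : 0 ≤ x := fun j => Finset.sum_nonneg fun k _ => by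
    split_ifs
    · exact Rat.cast_nonneg.2 (hz k)
    · exact le_rfl
  have hsum : ∀ y : Fin n → ℝ, (∀ j, j ∉ Set.range c → y j = 0) → ∀ i,
      (B *ᵥ y) i = ∑ k, B i (c k) * y (c k) := by
    intro y hy i
    simp only [Matrix.mulVec, dotProduct]
    symm
    refine Finset.sum_of_injOn c hc.injOn (by simp) ?_ (by simp)
    intro j _ hj
    rw [hy j, mul_zero]
    simpa using hj
  have hBr : ∀ i, (B *ᵥ x) (r i) = br i := by
    intro i
    rw [hsum x hx0]
    simp only [hxc]
    have := hRz i
    have h2 : ((∑ k, R i k * z k : ℚ) : ℝ) = ((br i : ℚ) : ℝ) := by rw [this]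
    push_cast at h2
    exact h2
  let b : Fin m → ℤ := fun i => ⌈(B *ᵥ x) i⌉
  have hbr : ∀ i, b (r i) = br i := fun i => by simp [b, hBr]
  have hxP : B *ᵥ x ≤ (fun i => (b i : ℝ)) ∧ 0 ≤ x := ⟨fun i => Int.le_ceil _, hxnn⟩
  -- objective
  let w : Fin n → ℝ := fun j => ∑ i, B (r i) j - if j ∈ Set.range c then 0 else 1
  have hw : ∀ y, w ⬝ᵥ y = ∑ i, (B *ᵥ y) (r i) - ∑ j, if j ∈ Set.range c then 0 else y j := by
    intro y
    simp only [w, dotProduct, sub_mul, Finset.sum_sub_distrib, Matrix.mulVec, Finset.sum_mul]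
    rw [Finset.sum_comm]
    simp
  have hbound : ∀ y, (B *ᵥ y ≤ (fun i => (b i : ℝ)) ∧ 0 ≤ y) → w ⬝ᵥ y ≤ ∑ i, (br i : ℝ) := by
    intro y hy
    rw [hw]
    have h1 : ∑ i, (B *ᵥ y) (r i) ≤ ∑ i, (br i : ℝ) := Finset.sum_le_sum fun i _ => by
      rw [← hbr]; exact hy.1 (r i)
    have h2 : 0 ≤ ∑ j, if j ∈ Set.range c then 0 else y j := Finset.sum_nonneg fun j _ => by
      split_ifs
      · exact le_rfl
      · exact hy.2 j
    linarith
  have hwx : w ⬝ᵥ x = ∑ i, (br i : ℝ) := by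
    rw [hw]
    have h2 : ∑ j, (if j ∈ Set.range c then 0 else x j) = 0 := Finset.sum_eq_zero fun j _ => by
      split_ifs with hj
      · rfl
      · exact hx0 j hj
    rw [h2, sub_zero]
    exact Finset.sum_congr rfl fun i _ => hBr i
  obtain ⟨y, hy, hyint, hymax⟩ := h b w ⟨x, hxP⟩ ⟨∑ i, (br i : ℝ), by
    rintro _ ⟨y, hy, rfl⟩
    exact hbound y hy⟩
  have hwy : w ⬝ᵥ y = ∑ i, (br i : ℝ) := le_antisymm (hbound y hy) (hwx ▸ hymax x hxP)
  rw [hw] at hwy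
  have h1' : ∀ i ∈ Finset.univ, (B *ᵥ y) (r i) ≤ (br i : ℝ) := fun i _ => by
    rw [← hbr]; exact hy.1 (r i)
  have h1 := Finset.sum_le_sum h1'
  have h2' : ∀ j ∈ Finset.univ, 0 ≤ if j ∈ Set.range c then 0 else y j := fun j _ => by
    split_ifs
    · exact le_rfl
    · exact hy.2 j
  have h2 := Finset.sum_nonneg h2'
  have e1 := (Finset.sum_eq_sum_iff_of_le h1').1 (by linarith)
  have e2 := (Finset.sum_eq_zero_iff_of_nonneg h2').1 (by linarith)
  have hy0 : ∀ j, j ∉ Set.range c → y j = 0 := fun j hj => by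
    have := e2 j (Finset.mem_univ _)
    rwa [if_neg hj] at this
  -- uniqueness
  have hinv : (Rat.castHom ℝ).mapMatrix R⁻¹ * (Rat.castHom ℝ).mapMatrix R = 1 := by
    rw [← map_mul, Matrix.nonsing_inv_mul _ (isUnit_iff_ne_zero.2 hdet), map_one]
  have hRR : (Rat.castHom ℝ).mapMatrix R *ᵥ (y ∘ c) = (Rat.castHom ℝ).mapMatrix R *ᵥ (x ∘ c) := by
    funext i
    have t1 := e1 i (Finset.mem_univ _)
    rw [← hBr, hsum y hy0, hsum x hx0] at t1
    exact t1
  have hyx : y ∘ c = x ∘ c := by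
    have := congrArg (fun v => (Rat.castHom ℝ).mapMatrix R⁻¹ *ᵥ v) hRR
    simpa only [Matrix.mulVec_mulVec, hinv, Matrix.one_mulVec] using this
  obtain ⟨u, hu⟩ := hyint (c i0)
  have h3 : y (c i0) = z i0 := (congrFun hyx i0).trans (hxc i0)
  rw [hu] at h3
  have h4 : (u : ℚ) = z i0 := by exact_mod_cast h3
  refine ⟨u - D * N, ?_⟩
  push_cast
  rw [h4]
  simp [z]

/-- A rational `m × n` matrix `A` is `1`-regular if and only if for every integer
vector `b`, the polyhedron `{x : A x ≤ b, x ≥ 0}` is integral. -/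
theorem one_regular_iff_integral_polyhedra {m n : ℕ} (A : Matrix (Fin m) (Fin n) ℚ) :
    IsKRegular 1 A ↔
      ∀ b : Fin m → ℤ,
        IsIntegralPolyhedron
          {x : Fin n → ℝ |
            (A.map fun q => (q : ℝ)).mulVec x ≤ (fun i => (b i : ℝ)) ∧ 0 ≤ x} :=
  ⟨fun hA b => forward A hA b, backward A⟩
end

section
/- Let A be a rational m × n matrix that is 1-regular. Then the 2m × n block matrix obtained by stacking A on top of −A (its rows are the rows of A followed by the rows of −A) is also 1-regular. -/
/-- If `A` is `1`-regular, then the block matrix obtained by stacking `A` on top of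
`-A` is also `1`-regular. -/
theorem one_regular_fromRows_neg {m n : ℕ} (A : Matrix (Fin m) (Fin n) ℚ)
    (h : IsKRegular 1 A) :
    IsKRegular 1 (Matrix.fromRows A (-A)) := by
  intro s r c hr hc hdet
  set r' : Fin s → Fin m := fun i => Sum.elim id id (r i) with hr'
  set e : Fin s → ℤ := fun i => Sum.elim (fun _ => 1) (fun _ => -1) (r i) with he
  have hee : ∀ i, (e i : ℚ) * (e i : ℚ) = 1 := by
    intro i
    simp only [he]
    rcases r i with x | x <;> simp
  have hM : (Matrix.fromRows A (-A)).submatrix r c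
      = Matrix.diagonal (fun i => (e i : ℚ)) * A.submatrix r' c := by
    ext i j
    rw [Matrix.diagonal_mul]
    simp only [Matrix.submatrix_apply, he, hr']
    rcases r i with x | x <;> simp
  rw [hM] at hdet ⊢
  have hB : (A.submatrix r' c).det ≠ 0 := by
    intro h0
    apply hdet
    rw [Matrix.det_mul, h0, mul_zero]
  have hinj : Function.Injective r' := by
    intro i j hij
    by_contra hne
    apply hB
    apply Matrix.det_zero_of_row_eq hne
    ext k
    simp [hij]
  have hD : (Matrix.diagonal (fun i => (e i : ℚ)))⁻¹ = Matrix.diagonal (fun i => (e i : ℚ)) := by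
    apply Matrix.inv_eq_right_inv
    rw [Matrix.diagonal_mul_diagonal]
    simp [hee]
  intro i j
  obtain ⟨z, hz⟩ := h s r' c hinj hc hB i j
  refine ⟨z * e j, ?_⟩
  rw [Matrix.mul_inv_rev, hD, Matrix.mul_diagonal, ← mul_assoc, hz]
  push_cast
  rfl
end
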